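/- arXiv:2011.11845 — 6 statements merged into one kernel-verified Lean document; each statement's English description precedes it below -/
import Mathlib

section
/- Let h₁, h₂ : [0,∞) → [0,∞) be C^∞ functions (smooth up to the endpoint 0, in the sense of one-sided derivatives) with hᵢ(0) = 0, hᵢ′(0) > 0, and hᵢ(x) > 0 for x > 0 (i = 1,2). Then the following three statements are equivalent: (i) the difference h₁ − h₂ is flat at the origin; (ii) the function x ↦ √(h₁(x)) − √(h₂(x)) is C^∞ on [0,∞); (iii) the function x ↦ √(h₁(x)) − √(h₂(x)) is C^∞ on [0,∞) and flat at the origin. -/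
open Set

/-- A function is *flat at the origin* (from the right) if all of its one-sided
iterated derivatives at `0`, taken within `[0,∞)`, vanish. -/
def FlatAtZeroOnIci (u : ℝ → ℝ) : Prop :=
  ∀ n : ℕ, iteratedDerivWithin n u (Set.Ici (0 : ℝ)) 0 = 0

open Asymptotics Filter Topology

/-- The formal Taylor series at `0` of a function on `[0,∞)`. -/
noncomputable def taylorSeriesIci (u : ℝ → ℝ) : PowerSeries ℝ :=
  PowerSeries.mk fun n => iteratedDerivWithin n u (Ici 0) 0 / n.factorial

theorem flatAtZeroOnIci_iff_taylorSeriesIci_eq_zero {u : ℝ → ℝ} :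
    FlatAtZeroOnIci u ↔ taylorSeriesIci u = 0 := by
  simp [FlatAtZeroOnIci, taylorSeriesIci, PowerSeries.ext_iff, Nat.factorial_ne_zero]

theorem taylorSeriesIci_congr {u v : ℝ → ℝ} (h : EqOn u v (Ici 0)) :
    taylorSeriesIci u = taylorSeriesIci v := by
  ext n
  simp [taylorSeriesIci, iteratedDerivWithin_congr h (self_mem_Ici (a := (0 : ℝ)))]

section

variable {u v : ℝ → ℝ}

theorem ContDiffOn.contDiffWithinAt_zero_nat (hu : ContDiffOn ℝ (⊤ : ℕ∞) u (Ici 0)) (n : ℕ) :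
    ContDiffWithinAt ℝ n u (Ici 0) 0 :=
  (contDiffOn_infty.1 hu n) 0 self_mem_Ici

theorem taylorSeriesIci_add (hu : ContDiffOn ℝ (⊤ : ℕ∞) u (Ici 0))
    (hv : ContDiffOn ℝ (⊤ : ℕ∞) v (Ici 0)) :
    taylorSeriesIci (u + v) = taylorSeriesIci u + taylorSeriesIci v := by
  ext n
  simp [taylorSeriesIci, iteratedDerivWithin_add (self_mem_Ici (a := (0 : ℝ)))
    (uniqueDiffOn_Ici 0) (hu.contDiffWithinAt_zero_nat n) (hv.contDiffWithinAt_zero_nat n),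
    add_div]

theorem taylorSeriesIci_mul (hu : ContDiffOn ℝ (⊤ : ℕ∞) u (Ici 0))
    (hv : ContDiffOn ℝ (⊤ : ℕ∞) v (Ici 0)) :
    taylorSeriesIci (u * v) = taylorSeriesIci u * taylorSeriesIci v := by
  ext n
  rw [PowerSeries.coeff_mul, Finset.Nat.sum_antidiagonal_eq_sum_range_succ_mk]
  simp only [taylorSeriesIci, PowerSeries.coeff_mk]
  rw [iteratedDerivWithin_mul self_mem_Ici (uniqueDiffOn_Ici 0)
    (hu.contDiffWithinAt_zero_nat n) (hv.contDiffWithinAt_zero_nat n), Finset.sum_div]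
  refine Finset.sum_congr rfl fun i hi => ?_
  have hi' : i ≤ n := by simpa [Nat.lt_succ_iff] using hi
  rw [Nat.cast_choose ℝ hi']
  have := Nat.factorial_ne_zero
  field_simp

theorem FlatAtZeroOnIci.mul (hf : FlatAtZeroOnIci u) (hu : ContDiffOn ℝ (⊤ : ℕ∞) u (Ici 0))
    (hv : ContDiffOn ℝ (⊤ : ℕ∞) v (Ici 0)) : FlatAtZeroOnIci (u * v) := by
  rw [flatAtZeroOnIci_iff_taylorSeriesIci_eq_zero] at hf ⊢
  rw [taylorSeriesIci_mul hu hv, hf, zero_mul]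

end

theorem FlatAtZeroOnIci.derivWithin {u : ℝ → ℝ} (hf : FlatAtZeroOnIci u) :
    FlatAtZeroOnIci (derivWithin u (Ici 0)) := fun n => by
  rw [← iteratedDerivWithin_succ']
  exact hf (n + 1)

theorem FlatAtZeroOnIci.apply_zero {u : ℝ → ℝ} (hf : FlatAtZeroOnIci u) : u 0 = 0 := by
  simpa using hf 0

theorem FlatAtZeroOnIci.isLittleO_pow {u : ℝ → ℝ} (hf : FlatAtZeroOnIci u)
    (hu : ContDiffOn ℝ (⊤ : ℕ∞) u (Ici 0)) (n : ℕ) :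
    u =o[𝓝[Ici 0] 0] fun x => x ^ n := by
  have := taylor_isLittleO (convex_Ici 0) self_mem_Ici (contDiffOn_infty.1 hu n)
  simpa [taylor_within_apply, hf _] using this

theorem order_taylorSeriesIci_eq_one {h : ℝ → ℝ} (h_zero : h 0 = 0)
    (h_deriv : derivWithin h (Ici 0) 0 ≠ 0) : (taylorSeriesIci h).order = 1 := by
  have := PowerSeries.order_eq_nat (φ := taylorSeriesIci h) (n := 1)
  rw [Nat.cast_one] at this
  rw [this]
  refine ⟨by simpa [taylorSeriesIci] using h_deriv, fun i hi => ?_⟩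
  obtain rfl : i = 0 := by omega
  simp [taylorSeriesIci, h_zero]

/-- An element of order one of a power series ring over a field is not a quotient of squares. -/
theorem PowerSeries.eq_zero_of_sq_eq_sq_mul {K : Type*} [Field K] {s g h : PowerSeries K}
    (h_order : h.order = 1) (e : s ^ 2 = g ^ 2 * h) : g = 0 := by
  have he := congrArg PowerSeries.order e
  rw [PowerSeries.order_mul, PowerSeries.order_pow, PowerSeries.order_pow, h_order] at he
  by_contra hg
  rw [← PowerSeries.coe_toNat_order hg] at he
  by_cases hs : s = 0
  · subst hs
    simp only [PowerSeries.order_zero] at he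
    have h2 : (2 : ℕ) • (⊤ : ℕ∞) = ⊤ := by simp
    rw [h2] at he
    have : ((2 * g.order.toNat + 1 : ℕ) : ℕ∞) = ⊤ := by rw [he]; simp
    exact ENat.natCast_ne_top _ this
  · rw [← PowerSeries.coe_toNat_order hs] at he
    have : 2 * s.order.toNat = 2 * g.order.toNat + 1 := by
      have := he
      simp only [nsmul_eq_mul] at this
      exact_mod_cast this
    omega

theorem isBigO_inv_sqrt {h : ℝ → ℝ} (h_smooth : ContDiffOn ℝ (⊤ : ℕ∞) h (Ici 0))
    (h_zero : h 0 = 0) (h_deriv : 0 < derivWithin h (Ici 0) 0) :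
    (fun x => (√(h x))⁻¹) =O[𝓝[Ici 0] 0] fun x : ℝ => x⁻¹ := by
  have hd : HasDerivWithinAt h (derivWithin h (Ici 0) 0) (Ici 0) 0 :=
    ((h_smooth.differentiableOn (by simp)) 0 self_mem_Ici).hasDerivWithinAt
  set c := derivWithin h (Ici 0) 0
  have ho := (hasDerivWithinAt_iff_isLittleO.1 hd).bound (half_pos h_deriv)
  refine IsBigO.of_bound (√(c / 2))⁻¹ ?_
  have h1 : ∀ᶠ x in 𝓝[Ici 0] (0 : ℝ), x < 1 :=
    mem_nhdsWithin_of_mem_nhds (Iio_mem_nhds one_pos)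
  filter_upwards [ho, h1, self_mem_nhdsWithin] with x hx hx1 hx0
  have hx0 : 0 ≤ x := hx0
  rcases hx0.eq_or_lt with rfl | hx0
  · simp [h_zero]
  simp only [h_zero, sub_zero, smul_eq_mul, Real.norm_eq_abs, abs_of_pos hx0] at hx
  have hle : c / 2 * x ≤ h x := by
    have := (abs_le.1 hx).1
    linarith
  have hle' : √(c / 2) * x ≤ √(h x) := by
    refine Real.le_sqrt_of_sq_le ?_
    rw [mul_pow, Real.sq_sqrt (half_pos h_deriv).le]
    refine le_trans ?_ hle
    exact mul_le_mul_of_nonneg_left (by nlinarith) (half_pos h_deriv).le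
  have hc : 0 < √(c / 2) := Real.sqrt_pos.2 (half_pos h_deriv)
  rw [Real.norm_of_nonneg (by positivity), Real.norm_of_nonneg (by positivity), ← mul_inv]
  exact inv_anti₀ (by positivity) hle'

theorem HasDerivWithinAt.pow_of_eq_sq_mul {p : ℝ → ℝ} {d x : ℝ} {s : Set ℝ}
    (hp : HasDerivWithinAt p (p x ^ 2 * d) s x) (a : ℕ) :
    HasDerivWithinAt (fun y => p y ^ a) (a * p x ^ (a + 1) * d) s x := by
  refine (hp.fun_pow a).congr_deriv ?_
  cases a with
  | zero => simp
  | succ a => simp; ring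

theorem HasDerivWithinAt.inv_sqrt {h : ℝ → ℝ} {h' x : ℝ} {s : Set ℝ}
    (hh : HasDerivWithinAt h h' s x) (hx : 0 < h x) :
    HasDerivWithinAt (fun y => (√(h y))⁻¹)
      ((√(h x))⁻¹ ^ 2 * (-(1 / 2) * h' * (√(h x))⁻¹)) s x := by
  have hs : √(h x) ≠ 0 := (Real.sqrt_pos.2 hx).ne'
  refine ((hh.sqrt hx.ne').fun_inv hs).congr_deriv ?_
  field_simp

theorem HasDerivWithinAt.inv_sqrt_add_sqrt {h k : ℝ → ℝ} {h' k' x : ℝ} {s : Set ℝ}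
    (hh : HasDerivWithinAt h h' s x) (hk : HasDerivWithinAt k k' s x)
    (hx : 0 < h x) (kx : 0 < k x) :
    HasDerivWithinAt (fun y => (√(h y) + √(k y))⁻¹)
      ((√(h x) + √(k x))⁻¹ ^ 2 *
        (-(1 / 2) * h' * (√(h x))⁻¹ + -(1 / 2) * k' * (√(k x))⁻¹)) s x := by
  have hs : 0 < √(h x) := Real.sqrt_pos.2 hx
  have ks : 0 < √(k x) := Real.sqrt_pos.2 kx
  refine (((hh.sqrt hx.ne').fun_add (hk.sqrt kx.ne')).fun_inv (by positivity)).congr_deriv ?_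
  field_simp
  ring

/-- The function `f` divided by powers of `√h`, `√k` and `√h + √k`. -/
noncomputable def sqrtQuotient (h k f : ℝ → ℝ) (a b c : ℕ) (x : ℝ) : ℝ :=
  f x * (√(h x))⁻¹ ^ a * (√(k x))⁻¹ ^ b * (√(h x) + √(k x))⁻¹ ^ c

section

variable {h k : ℝ → ℝ} (h_smooth : ContDiffOn ℝ (⊤ : ℕ∞) h (Ici 0))
  (k_smooth : ContDiffOn ℝ (⊤ : ℕ∞) k (Ici 0)) (h_zero : h 0 = 0) (k_zero : k 0 = 0)
  (h_deriv : 0 < derivWithin h (Ici 0) 0) (k_deriv : 0 < derivWithin k (Ici 0) 0)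
  (h_pos : ∀ x : ℝ, 0 < x → 0 < h x) (k_pos : ∀ x : ℝ, 0 < x → 0 < k x)

include h_smooth k_smooth h_zero k_zero h_deriv k_deriv h_pos in
theorem hasDerivWithinAt_sqrtQuotient_zero {f : ℝ → ℝ} (f_flat : FlatAtZeroOnIci f)
    (f_smooth : ContDiffOn ℝ (⊤ : ℕ∞) f (Ici 0)) (a b c : ℕ) :
    HasDerivWithinAt (sqrtQuotient h k f a b c) 0 (Ici 0) 0 := by
  rw [hasDerivWithinAt_iff_isLittleO]
  have hp := isBigO_inv_sqrt h_smooth h_zero h_deriv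
  have hq := isBigO_inv_sqrt k_smooth k_zero k_deriv
  have hr : (fun x => (√(h x) + √(k x))⁻¹) =O[𝓝[Ici 0] 0] fun x : ℝ => x⁻¹ := by
    refine IsBigO.trans (IsBigO.of_bound 1 ?_) hp
    filter_upwards [self_mem_nhdsWithin] with x hx
    rcases (show (0 : ℝ) ≤ x from hx).eq_or_lt with rfl | hx
    · simp [h_zero, k_zero]
    have hs := Real.sqrt_pos.2 (h_pos x hx)
    rw [Real.norm_of_nonneg (by positivity), Real.norm_of_nonneg (by positivity), one_mul]
    exact inv_anti₀ hs (le_add_of_nonneg_right (Real.sqrt_nonneg _))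
  have key := (((f_flat.isLittleO_pow f_smooth (a + b + c + 1)).mul_isBigO (hp.pow a)).mul_isBigO
    (hq.pow b)).mul_isBigO (hr.pow c)
  simp only [sqrtQuotient, f_flat.apply_zero, zero_mul, sub_zero, smul_zero]
  refine key.congr_right fun x => ?_
  rcases eq_or_ne x 0 with rfl | hx
  · simp
  · simp only [pow_add, inv_pow, pow_one]
    field_simp

include h_smooth k_smooth h_zero k_zero h_deriv k_deriv h_pos k_pos in
theorem hasDerivWithinAt_sqrtQuotient {f : ℝ → ℝ} (f_flat : FlatAtZeroOnIci f)
    (f_smooth : ContDiffOn ℝ (⊤ : ℕ∞) f (Ici 0)) (a b c : ℕ) {x : ℝ} (hx : 0 ≤ x) :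
    HasDerivWithinAt (sqrtQuotient h k f a b c)
      (sqrtQuotient h k (derivWithin f (Ici 0)) a b c x
        + sqrtQuotient h k (f * fun y => -(a / 2) * derivWithin h (Ici 0) y) (a + 2) b c x
        + sqrtQuotient h k (f * fun y => -(b / 2) * derivWithin k (Ici 0) y) a (b + 2) c x
        + sqrtQuotient h k (f * fun y => -(c / 2) * derivWithin h (Ici 0) y) (a + 1) b (c + 1) x
        + sqrtQuotient h k (f * fun y => -(c / 2) * derivWithin k (Ici 0) y) a (b + 1) (c + 1) x)
      (Ici 0) x := by
  rcases hx.eq_or_lt with rfl | hx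
  · refine (hasDerivWithinAt_sqrtQuotient_zero h_smooth k_smooth h_zero k_zero h_deriv k_deriv
      h_pos f_flat f_smooth a b c).congr_deriv ?_
    simp [sqrtQuotient, f_flat.apply_zero, f_flat.derivWithin.apply_zero]
  · have hasDeriv : ∀ {u : ℝ → ℝ}, ContDiffOn ℝ (⊤ : ℕ∞) u (Ici 0) →
        HasDerivWithinAt u (derivWithin u (Ici 0) x) (Ici 0) x := fun hu =>
      ((hu.differentiableOn (by simp)) x hx.le).hasDerivWithinAt
    have hh := hasDeriv h_smooth
    have hk := hasDeriv k_smooth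
    refine ((((hasDeriv f_smooth).fun_mul ((hh.inv_sqrt (h_pos x hx)).pow_of_eq_sq_mul a)).fun_mul
      ((hk.inv_sqrt (k_pos x hx)).pow_of_eq_sq_mul b)).fun_mul
      ((hh.inv_sqrt_add_sqrt hk (h_pos x hx) (k_pos x hx)).pow_of_eq_sq_mul c)).congr_deriv ?_
    simp only [sqrtQuotient, Pi.mul_apply]
    ring

include h_smooth k_smooth h_zero k_zero h_deriv k_deriv h_pos k_pos in
theorem contDiffOn_sqrtQuotient {f : ℝ → ℝ} (f_flat : FlatAtZeroOnIci f)
    (f_smooth : ContDiffOn ℝ (⊤ : ℕ∞) f (Ici 0)) (a b c : ℕ) :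
    ContDiffOn ℝ (⊤ : ℕ∞) (sqrtQuotient h k f a b c) (Ici 0) := by
  refine contDiffOn_infty.2 fun n => ?_
  induction n generalizing f a b c with
  | zero =>
    exact contDiffOn_zero.2 fun x hx => (hasDerivWithinAt_sqrtQuotient h_smooth k_smooth h_zero
      k_zero h_deriv k_deriv h_pos k_pos f_flat f_smooth a b c hx).continuousWithinAt
  | succ n ih =>
    have hd := fun x (hx : x ∈ Ici (0 : ℝ)) => hasDerivWithinAt_sqrtQuotient h_smooth k_smooth
      h_zero k_zero h_deriv k_deriv h_pos k_pos f_flat f_smooth a b c hx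
    have smooth_deriv : ∀ {u : ℝ → ℝ}, ContDiffOn ℝ (⊤ : ℕ∞) u (Ici 0) →
        ContDiffOn ℝ (⊤ : ℕ∞) (derivWithin u (Ici 0)) (Ici 0) := fun hu =>
      hu.derivWithin (uniqueDiffOn_Ici 0) (by simp)
    have term : ∀ {u : ℝ → ℝ} (r : ℝ) (a b c : ℕ), ContDiffOn ℝ (⊤ : ℕ∞) u (Ici 0) →
        ContDiffOn ℝ n (sqrtQuotient h k (f * fun y => r * derivWithin u (Ici 0) y) a b c)
          (Ici 0) := fun r a b c hu => by
      have := contDiffOn_const (c := r).mul (smooth_deriv hu)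
      exact ih (f_flat.mul f_smooth this) (f_smooth.mul this) a b c
    rw [Nat.cast_succ, contDiffOn_succ_iff_derivWithin (uniqueDiffOn_Ici 0)]
    refine ⟨fun x hx => (hd x hx).differentiableWithinAt, by simp, ?_⟩
    refine ContDiffOn.congr ?_ fun x hx => (hd x hx).derivWithin (uniqueDiffOn_Ici 0 x hx)
    exact ((((ih f_flat.derivWithin (smooth_deriv f_smooth) a b c).add
      (term _ _ _ _ h_smooth)).add (term _ _ _ _ k_smooth)).add (term _ _ _ _ h_smooth)).add
      (term _ _ _ _ k_smooth)

include h_smooth k_smooth h_zero k_zero h_deriv k_deriv h_pos k_pos in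
theorem contDiffOn_sqrt_sub_sqrt_of_flat (flat : FlatAtZeroOnIci fun x => h x - k x) :
    ContDiffOn ℝ (⊤ : ℕ∞) (fun x => √(h x) - √(k x)) (Ici 0) := by
  refine (contDiffOn_sqrtQuotient h_smooth k_smooth h_zero k_zero h_deriv k_deriv h_pos k_pos
    flat (h_smooth.sub k_smooth) 0 0 1).congr fun x hx => ?_
  rcases (show (0 : ℝ) ≤ x from hx).eq_or_lt with rfl | hx
  · simp [sqrtQuotient, h_zero, k_zero]
  · have hs := Real.sqrt_pos.2 (h_pos x hx)
    have ks := Real.sqrt_pos.2 (k_pos x hx)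
    simp only [sqrtQuotient, pow_zero, mul_one, pow_one]
    field_simp
    nlinarith [Real.sq_sqrt (h_pos x hx).le, Real.sq_sqrt (k_pos x hx).le]

end

section

variable {h k : ℝ → ℝ} (h_smooth : ContDiffOn ℝ (⊤ : ℕ∞) h (Ici 0))
  (k_smooth : ContDiffOn ℝ (⊤ : ℕ∞) k (Ici 0))
  (h_nonneg : ∀ x ∈ Ici (0 : ℝ), 0 ≤ h x) (k_nonneg : ∀ x ∈ Ici (0 : ℝ), 0 ≤ k x)
  (k_zero : k 0 = 0) (k_deriv : 0 < derivWithin k (Ici 0) 0)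

include h_smooth k_smooth h_nonneg k_nonneg k_zero k_deriv in
theorem flat_of_contDiffOn_sqrt_sub_sqrt
    (g_smooth : ContDiffOn ℝ (⊤ : ℕ∞) (fun x => √(h x) - √(k x)) (Ici 0)) :
    FlatAtZeroOnIci (fun x => h x - k x) ∧ FlatAtZeroOnIci (fun x => √(h x) - √(k x)) := by
  set g : ℝ → ℝ := fun x => √(h x) - √(k x) with hg
  -- `s = h - k - g ^ 2` satisfies `s ^ 2 = (2 * g) ^ 2 * k`
  set s : ℝ → ℝ := fun x => h x - k x - g x * g x with hs
  have s_smooth : ContDiffOn ℝ (⊤ : ℕ∞) s (Ici 0) :=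
    (h_smooth.sub k_smooth).sub (g_smooth.mul g_smooth)
  have e : EqOn (s * s) ((g + g) * (g + g) * k) (Ici 0) := fun x hx => by
    have h1 := Real.sq_sqrt (h_nonneg x hx)
    have h2 := Real.sq_sqrt (k_nonneg x hx)
    have hsx : s x = 2 * g x * √(k x) := by
      simp only [hs, hg]
      linear_combination -h1 + h2
    simp only [Pi.mul_apply, Pi.add_apply, hsx]
    linear_combination 4 * g x ^ 2 * h2
  have gg_smooth : ContDiffOn ℝ (⊤ : ℕ∞) (g + g) (Ici 0) := g_smooth.add g_smooth
  have eT := taylorSeriesIci_congr e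
  rw [taylorSeriesIci_mul s_smooth s_smooth,
    taylorSeriesIci_mul (u := (g + g) * (g + g)) (ContDiffOn.mul gg_smooth gg_smooth) k_smooth,
    taylorSeriesIci_mul gg_smooth gg_smooth, ← sq, ← sq] at eT
  have hgg := PowerSeries.eq_zero_of_sq_eq_sq_mul
    (order_taylorSeriesIci_eq_one k_zero k_deriv.ne') eT
  have sT : taylorSeriesIci s = 0 := by simpa [hgg] using eT
  have gT : taylorSeriesIci g = 0 := by
    rw [taylorSeriesIci_add g_smooth g_smooth] at hgg
    ext n
    simpa using congrArg (PowerSeries.coeff n) hgg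
  refine ⟨?_, flatAtZeroOnIci_iff_taylorSeriesIci_eq_zero.2 gT⟩
  rw [flatAtZeroOnIci_iff_taylorSeriesIci_eq_zero,
    taylorSeriesIci_congr (v := s + g * g) fun x _ => by simp [hs],
    taylorSeriesIci_add (v := g * g) s_smooth (g_smooth.mul g_smooth),
    taylorSeriesIci_mul g_smooth g_smooth, sT, gT]
  simp

end

theorem lemma_sqrt_diff (h₁ h₂ : ℝ → ℝ)
    (smooth₁ : ContDiffOn ℝ (⊤ : ℕ∞) h₁ (Set.Ici 0))
    (smooth₂ : ContDiffOn ℝ (⊤ : ℕ∞) h₂ (Set.Ici 0))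
    (nonneg₁ : ∀ x ∈ Set.Ici (0 : ℝ), 0 ≤ h₁ x)
    (nonneg₂ : ∀ x ∈ Set.Ici (0 : ℝ), 0 ≤ h₂ x)
    (zero₁ : h₁ 0 = 0) (zero₂ : h₂ 0 = 0)
    (deriv₁ : 0 < derivWithin h₁ (Set.Ici 0) 0)
    (deriv₂ : 0 < derivWithin h₂ (Set.Ici 0) 0)
    (pos₁ : ∀ x : ℝ, 0 < x → 0 < h₁ x)
    (pos₂ : ∀ x : ℝ, 0 < x → 0 < h₂ x) :
    (FlatAtZeroOnIci (fun x => h₁ x - h₂ x) ↔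
      ContDiffOn ℝ (⊤ : ℕ∞) (fun x => Real.sqrt (h₁ x) - Real.sqrt (h₂ x)) (Set.Ici 0)) ∧
    (FlatAtZeroOnIci (fun x => h₁ x - h₂ x) ↔
      (ContDiffOn ℝ (⊤ : ℕ∞) (fun x => Real.sqrt (h₁ x) - Real.sqrt (h₂ x)) (Set.Ici 0) ∧
        FlatAtZeroOnIci (fun x => Real.sqrt (h₁ x) - Real.sqrt (h₂ x)))) := by
  have to_smooth := contDiffOn_sqrt_sub_sqrt_of_flat smooth₁ smooth₂ zero₁ zero₂ deriv₁ deriv₂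
    pos₁ pos₂
  have to_flat := flat_of_contDiffOn_sqrt_sub_sqrt smooth₁ smooth₂ nonneg₁ nonneg₂ zero₂ deriv₂
  exact ⟨⟨to_smooth, fun g => (to_flat g).1⟩,
    ⟨fun f => ⟨to_smooth f, (to_flat (to_smooth f)).2⟩, fun g => (to_flat g.1).1⟩⟩
end

section
/- Let g : [0,∞) → ℝ be a C^∞ function (smooth up to the endpoint 0 in the sense of one-sided derivatives) such that the function x ↦ √x · g(x) is also C^∞ on [0,∞). Then g is flat at the origin, i.e., g and all of its iterated one-sided derivatives vanish at 0. -/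
open Set

open Filter Topology

/-- If the one-sided derivatives of `f` at `0` of order less than `n` vanish, then `f x / x ^ n`
tends to the `n`-th Taylor coefficient as `x` tends to `0` from the right. -/
theorem tendsto_div_pow_of_iteratedDerivWithin_eq_zero {f : ℝ → ℝ} {n : ℕ}
    (hf : ContDiffOn ℝ n f (Ici 0))
    (h0 : ∀ k < n, iteratedDerivWithin k f (Ici 0) 0 = 0) :
    Tendsto (fun x => f x / x ^ n) (𝓝[>] 0)
      (𝓝 (iteratedDerivWithin n f (Ici 0) 0 / n.factorial)) := by
  have hlittle := (taylor_isLittleO (convex_Ici (0 : ℝ)) self_mem_Ici hf).mono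
    (nhdsWithin_mono 0 Ioi_subset_Ici_self)
  have hlim := hlittle.tendsto_div_nhds_zero.add_const
    (iteratedDerivWithin n f (Ici 0) 0 / n.factorial)
  rw [zero_add] at hlim
  refine hlim.congr' ?_
  filter_upwards [self_mem_nhdsWithin] with x hx
  have hx' : x ≠ 0 := ne_of_gt hx
  have htaylor : taylorWithinEval f n (Ici 0) 0 x =
      x ^ n * (iteratedDerivWithin n f (Ici 0) 0 / n.factorial) := by
    rw [taylor_within_apply, Finset.sum_range_succ, Finset.sum_eq_zero]
    · simp only [sub_zero, smul_eq_mul, zero_add]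
      ring
    · intro k hk
      rw [h0 k (Finset.mem_range.mp hk), smul_zero]
  rw [htaylor, sub_zero]
  field_simp
  ring

theorem smooth_sqrt_mul_flat (g : ℝ → ℝ)
    (hg : ContDiffOn ℝ (⊤ : ℕ∞) g (Set.Ici 0))
    (hsg : ContDiffOn ℝ (⊤ : ℕ∞) (fun x => Real.sqrt x * g x) (Set.Ici 0)) :
    FlatAtZeroOnIci g := by
  have hsqrt : Tendsto Real.sqrt (𝓝[>] 0) (𝓝 0) := by
    simpa using (Real.continuous_sqrt.tendsto 0).mono_left nhdsWithin_le_nhds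
  have hfin : ∀ m : ℕ, ((m : ℕ∞) : WithTop ℕ∞) ≤ ((⊤ : ℕ∞) : WithTop ℕ∞) :=
    fun m => by exact_mod_cast le_top
  suffices h : ∀ n : ℕ, iteratedDerivWithin n g (Ici 0) 0 = 0 ∧
      iteratedDerivWithin n (fun x => Real.sqrt x * g x) (Ici 0) 0 = 0 from fun n => (h n).1
  intro n
  induction n using Nat.strong_induction_on with
  | _ n ih =>
    have hfac : (n.factorial : ℝ) ≠ 0 := by positivity
    have hglim := tendsto_div_pow_of_iteratedDerivWithin_eq_zero (hg.of_le (hfin n))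
      fun k hk => (ih k hk).1
    have hslim := tendsto_div_pow_of_iteratedDerivWithin_eq_zero (hsg.of_le (hfin n))
      fun k hk => (ih k hk).2
    have hs : iteratedDerivWithin n (fun x => Real.sqrt x * g x) (Ici 0) 0 = 0 := by
      have hprod := hsqrt.mul hglim
      simp only [zero_mul, ← mul_div_assoc] at hprod
      simpa [hfac] using tendsto_nhds_unique hslim hprod
    refine ⟨?_, hs⟩
    have hslim' := tendsto_div_pow_of_iteratedDerivWithin_eq_zero (hsg.of_le (hfin (n + 1)))
      fun k hk => (Nat.lt_succ_iff_lt_or_eq.mp hk).elim (fun h => (ih k h).2) (fun h => h ▸ hs)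
    have hprod := hsqrt.mul hslim'
    rw [zero_mul] at hprod
    have hzero : Tendsto (fun x => g x / x ^ n) (𝓝[>] 0) (𝓝 0) := by
      refine hprod.congr' ?_
      filter_upwards [self_mem_nhdsWithin] with x hx
      have hx' : x ≠ 0 := ne_of_gt hx
      rw [← mul_div_assoc, ← mul_assoc, Real.mul_self_sqrt (le_of_lt hx), pow_succ',
        mul_div_mul_left _ _ hx']
    simpa [hfac] using tendsto_nhds_unique hglim hzero
end

section
/- Let f, g : ℝ → ℝ be C^∞ functions with f(0) = g(0) = 0, f′(0) ≠ 0 and g′(0) ≠ 0. If the difference f³ − g³ (pointwise cubes) is flat at the origin, then the difference f − g is flat at the origin; i.e., equality of the Taylor series of f³ and g³ at 0 implies equality of the Taylor series of f and g at 0. -/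
/-- A function `u : ℝ → ℝ` is *flat at the origin* if all of its iterated
derivatives at `0` vanish (in particular its value, the `0`-th derivative). -/
def FlatAtZero (u : ℝ → ℝ) : Prop :=
  ∀ n : ℕ, iteratedDeriv n u 0 = 0

/-- The formal Taylor series at the origin of a function `u : ℝ → ℝ`. -/
noncomputable def taylorPowerSeries (u : ℝ → ℝ) : PowerSeries ℝ :=
  PowerSeries.mk fun n => iteratedDeriv n u 0 / n.factorial

theorem coeff_taylorPowerSeries (u : ℝ → ℝ) (n : ℕ) :
    PowerSeries.coeff n (taylorPowerSeries u) = iteratedDeriv n u 0 / n.factorial :=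
  PowerSeries.coeff_mk _ _

theorem flatAtZero_iff_taylorPowerSeries_eq_zero (u : ℝ → ℝ) :
    FlatAtZero u ↔ taylorPowerSeries u = 0 := by
  simp [FlatAtZero, PowerSeries.ext_iff, coeff_taylorPowerSeries, Nat.factorial_ne_zero]

theorem taylorPowerSeries_sub {u v : ℝ → ℝ} (hu : ContDiff ℝ (⊤ : ℕ∞) u)
    (hv : ContDiff ℝ (⊤ : ℕ∞) v) :
    taylorPowerSeries (u - v) = taylorPowerSeries u - taylorPowerSeries v := by
  ext n
  have hn : (n : WithTop ℕ∞) ≤ ((⊤ : ℕ∞) : WithTop ℕ∞) := by exact_mod_cast le_top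
  simp only [coeff_taylorPowerSeries, map_sub]
  rw [iteratedDeriv_sub (hu.of_le hn).contDiffAt (hv.of_le hn).contDiffAt, sub_div]

theorem taylorPowerSeries_mul {u v : ℝ → ℝ} (hu : ContDiff ℝ (⊤ : ℕ∞) u)
    (hv : ContDiff ℝ (⊤ : ℕ∞) v) :
    taylorPowerSeries (u * v) = taylorPowerSeries u * taylorPowerSeries v := by
  ext n
  have hn : (n : WithTop ℕ∞) ≤ ((⊤ : ℕ∞) : WithTop ℕ∞) := by exact_mod_cast le_top
  rw [PowerSeries.coeff_mul, Finset.Nat.sum_antidiagonal_eq_sum_range_succ_mk]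
  simp only [coeff_taylorPowerSeries]
  rw [iteratedDeriv_mul (hu.of_le hn).contDiffAt (hv.of_le hn).contDiffAt, Finset.sum_div]
  refine Finset.sum_congr rfl fun i hi => ?_
  rw [Nat.cast_choose ℝ (Nat.lt_succ_iff.mp (Finset.mem_range.mp hi))]
  have := Nat.factorial_ne_zero n
  field_simp

theorem taylorPowerSeries_pow_three {u : ℝ → ℝ} (hu : ContDiff ℝ (⊤ : ℕ∞) u) :
    taylorPowerSeries (u ^ 3) = taylorPowerSeries u ^ 3 := by
  rw [pow_three, pow_three, taylorPowerSeries_mul (v := u * u) hu (hu.mul hu),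
    taylorPowerSeries_mul hu hu]

theorem PowerSeries.eq_of_pow_three_eq {F G : PowerSeries ℝ}
    (hF : PowerSeries.coeff 0 F = 0) (hG : PowerSeries.coeff 0 G = 0)
    (hF' : PowerSeries.coeff 1 F ≠ 0) (h : F ^ 3 = G ^ 3) : F = G := by
  have hmul : (F - G) * (F * F + F * G + G * G) = 0 := by linear_combination h
  refine sub_eq_zero.mp ((mul_eq_zero.mp hmul).resolve_right fun hq => hF' ?_)
  have hc := congrArg (PowerSeries.coeff 2) hq
  simp only [map_add, map_zero, PowerSeries.coeff_mul,
    Finset.Nat.sum_antidiagonal_eq_sum_range_succ_mk, Finset.sum_range_succ,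
    Finset.sum_range_zero, hF, hG] at hc
  norm_num at hc
  nlinarith [sq_nonneg (PowerSeries.coeff 1 F + 2 * PowerSeries.coeff 1 G),
    sq_pos_of_ne_zero hF']

theorem flat_cube_diff_implies_flat_diff (f g : ℝ → ℝ)
    (hf : ContDiff ℝ (⊤ : ℕ∞) f) (hg : ContDiff ℝ (⊤ : ℕ∞) g)
    (hf0 : f 0 = 0) (hg0 : g 0 = 0)
    (hf' : deriv f 0 ≠ 0) (hg' : deriv g 0 ≠ 0)
    (hcube : FlatAtZero (fun x => (f x) ^ 3 - (g x) ^ 3)) :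
    FlatAtZero (fun x => f x - g x) := by
  change FlatAtZero (f ^ 3 - g ^ 3) at hcube
  change FlatAtZero (f - g)
  rw [flatAtZero_iff_taylorPowerSeries_eq_zero] at hcube ⊢
  rw [taylorPowerSeries_sub (u := f ^ 3) (v := g ^ 3) (hf.pow 3) (hg.pow 3),
    taylorPowerSeries_pow_three hf,
    taylorPowerSeries_pow_three hg, sub_eq_zero] at hcube
  rw [taylorPowerSeries_sub hf hg, sub_eq_zero]
  refine PowerSeries.eq_of_pow_three_eq ?_ ?_ ?_ hcube
  · simp [coeff_taylorPowerSeries, hf0]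
  · simp [coeff_taylorPowerSeries, hg0]
  · simpa [coeff_taylorPowerSeries] using hf'
end

section
/- Let f, g : ℝ → ℝ be C^∞ functions with f(0) = g(0) = 0, f′(0) ≠ 0, g′(0) ≠ 0, and suppose that f − g is flat at the origin. Let φ and γ be C^∞ local inverses of f and g respectively, defined on a neighborhood of 0 (so that f(φ(y)) = y and g(γ(y)) = y for all y near 0, and φ(0) = γ(0) = 0). Then the difference φ − γ is flat at the origin. -/
open Filter Topology Asymptotics

/-- **Taylor's theorem** in Peano form at a point, for a function that is only locally smooth. -/
theorem ContDiffAt.sub_taylor_isLittleO {u : ℝ → ℝ} {x₀ : ℝ} {n : ℕ} (hu : ContDiffAt ℝ n u x₀) :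
    (fun x => u x - ∑ k ∈ Finset.range (n + 1),
      ((k.factorial : ℝ)⁻¹ * (x - x₀) ^ k) • iteratedDeriv k u x₀) =o[𝓝 x₀]
        fun x => (x - x₀) ^ n := by
  obtain ⟨s, hs, hus⟩ := hu.contDiffOn le_rfl (by simp)
  obtain ⟨r, hr, hrs⟩ := Metric.mem_nhds_iff.1 hs
  have hx₀ : x₀ ∈ Metric.ball x₀ r := Metric.mem_ball_self hr
  have h := taylor_isLittleO (convex_ball x₀ r) hx₀ (hus.mono hrs)
  rw [Metric.isOpen_ball.nhdsWithin_eq hx₀] at h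
  simpa only [taylor_within_apply, iteratedDerivWithin_of_isOpen Metric.isOpen_ball hx₀] using h

theorem flatAtZero_iff_forall_isLittleO {u : ℝ → ℝ} (hu : ContDiffAt ℝ (⊤ : ℕ∞) u 0) :
    FlatAtZero u ↔ ∀ n : ℕ, u =o[𝓝 0] fun x => x ^ n := by
  have htaylor (n : ℕ) := (hu.of_le (by exact_mod_cast le_top) :
    ContDiffAt ℝ n u 0).sub_taylor_isLittleO
  simp only [sub_zero, smul_eq_mul] at htaylor
  refine ⟨fun h n => by simpa [h _] using htaylor n, fun h n => ?_⟩
  induction n using Nat.strong_induction_on with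
  | _ n ih =>
    have hmonomial : (fun x : ℝ => ((n.factorial : ℝ)⁻¹ * iteratedDeriv n u 0) * x ^ n) =o[𝓝 0]
        fun x => x ^ n := by
      refine ((h n).sub (htaylor n)).congr_left fun x => ?_
      rw [Finset.sum_range_succ, Finset.sum_eq_zero fun k hk => by
        rw [ih k (Finset.mem_range.1 hk), mul_zero]]
      ring
    by_contra hne
    have hself : (fun x : ℝ => x ^ n) =o[𝓝[≠] 0] fun x => x ^ n :=
      ((isLittleO_const_mul_left_iff (mul_ne_zero (by positivity) hne)).1 hmonomial).mono
        nhdsWithin_le_nhds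
    refine (isLittleO_irrefl ?_) hself
    refine Eventually.frequently ?_
    filter_upwards [self_mem_nhdsWithin] with x hx
    exact pow_ne_zero n hx


theorem flat_diff_implies_flat_inverse_diff (f g φ γ : ℝ → ℝ)
    (hf : ContDiff ℝ (⊤ : ℕ∞) f) (hg : ContDiff ℝ (⊤ : ℕ∞) g)
    (hf0 : f 0 = 0) (hg0 : g 0 = 0)
    (hf' : deriv f 0 ≠ 0) (hg' : deriv g 0 ≠ 0)
    (hflat : FlatAtZero (fun x => f x - g x))
    (U : Set ℝ) (hU : U ∈ nhds (0 : ℝ))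
    (hφ : ContDiffOn ℝ (⊤ : ℕ∞) φ U) (hγ : ContDiffOn ℝ (⊤ : ℕ∞) γ U)
    (hφinv : ∀ y ∈ U, f (φ y) = y) (hγinv : ∀ y ∈ U, g (γ y) = y)
    (hφ0 : φ 0 = 0) (hγ0 : γ 0 = 0) :
    FlatAtZero (fun y => φ y - γ y) := by
  have hφ' : ContDiffAt ℝ (⊤ : ℕ∞) φ 0 := hφ.contDiffAt hU
  have hγ' : ContDiffAt ℝ (⊤ : ℕ∞) γ 0 := hγ.contDiffAt hU
  have hφt : Tendsto φ (𝓝 0) (𝓝 0) := by simpa [hφ0] using hφ'.continuousAt.tendsto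
  have hγt : Tendsto γ (𝓝 0) (𝓝 0) := by simpa [hγ0] using hγ'.continuousAt.tendsto
  have hγO : γ =O[𝓝 0] fun y => y := by
    simpa [hγ0] using (hγ'.differentiableAt (by simp)).isBigO_sub
  have hfg := (flatAtZero_iff_forall_isLittleO (hf.sub hg).contDiffAt).1 hflat
  rw [flatAtZero_iff_forall_isLittleO (hφ'.sub hγ')]
  intro n
  have hdiff : (fun y => φ y - γ y) =O[𝓝 0] fun y => f (φ y) - f (γ y) :=
    ((hf.contDiffAt.hasStrictDerivAt (x := 0) (by simp)).isTheta_sub hf').isBigO_symm.comp_tendsto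
      (hφt.prodMk_nhds hγt)
  have hcomp : (fun y => f (γ y) - g (γ y)) =o[𝓝 0] fun y => y ^ n :=
    ((hfg n).comp_tendsto hγt).trans_isBigO (hγO.pow n)
  refine hdiff.trans_isLittleO (hcomp.neg_left.congr' ?_ EventuallyEq.rfl)
  filter_upwards [hU] with y hy
  rw [hφinv y hy, hγinv y hy, neg_sub]
end

section
/- Let λ, λ̃ : ℝ → ℝ be C^∞ functions with λ(0) = λ̃(0) = 0, λ′(0) ≠ 0 and λ̃′(0) ≠ 0. Let H = {(p,q) ∈ ℝ² : q ≥ 0} be the closed upper half-plane, let U, V ⊆ H be neighborhoods of the origin in H, and let Φ = (Φ₁, Φ₂) : U → V be a C^∞ diffeomorphism such that Φ(0,0) = (0,0), Φ maps U ∩ {q = 0} into {q = 0}, Φ preserves two-dimensional Lebesgue measure (equivalently, the Jacobian determinant of Φ has absolute value 1 everywhere on U), and λ̃(Φ₂(p,q) − Φ₁(p,q)²) = λ(q − p²) for all (p,q) ∈ U. Then the Taylor series of λ and λ̃ at 0 coincide, i.e., λ − λ̃ is flat at the origin. -/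
open MeasureTheory Set

/-- The closed upper half-plane `H = {(p,q) : q ≥ 0}`. -/
def upperHalfPlane' : Set (ℝ × ℝ) := {x : ℝ × ℝ | 0 ≤ x.2}

open Filter Topology Asymptotics

theorem ContDiffAt.contDiffAt_deriv {u : ℝ → ℝ} {x : ℝ} {m n : WithTop ℕ∞}
    (hu : ContDiffAt ℝ n u x) (hmn : m + 1 ≤ n) : ContDiffAt ℝ m (deriv u) x :=
  (hu.fderiv_right hmn).clm_apply contDiffAt_const

/-- Taylor's theorem at the origin for a function whose first `n` derivatives vanish there. -/
theorem isLittleO_sub_monomial_of_iteratedDeriv_eq_zero (n : ℕ) :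
    ∀ u : ℝ → ℝ, ContDiffAt ℝ (⊤ : ℕ∞) u 0 → (∀ k < n, iteratedDeriv k u 0 = 0) →
      (fun x => u x - iteratedDeriv n u 0 / n.factorial * x ^ n) =o[𝓝 0] fun x => x ^ n := by
  induction n with
  | zero =>
    intro u hu _
    simp only [iteratedDeriv_zero, Nat.factorial_zero, Nat.cast_one, div_one, pow_zero, mul_one,
      isLittleO_one_iff]
    exact tendsto_sub_nhds_zero_iff.2 hu.continuousAt
  | succ n ih =>
    intro u hu hz
    have hd : ContDiffAt ℝ (⊤ : ℕ∞) (deriv u) 0 := hu.contDiffAt_deriv (by simp)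
    have key := ih (deriv u) hd fun k hk => by
      rw [← iteratedDeriv_succ']
      exact hz (k + 1) (by omega)
    rw [← iteratedDeriv_succ'] at key
    have hev : ∀ᶠ x in 𝓝 (0 : ℝ), DifferentiableAt ℝ u x :=
      ((hu.of_le (m := 1) (by norm_cast)).eventually (by simp)).mono
        fun x hx => hx.differentiableAt (by simp)
    obtain ⟨δ, hδ, hball⟩ := Metric.eventually_nhds_iff_ball.1 hev
    set a := iteratedDeriv (n + 1) u 0
    have hderiv : ∀ x ∈ Metric.ball (0 : ℝ) δ,
        HasDerivWithinAt (fun x => u x - a / (n + 1).factorial * x ^ (n + 1))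
          (deriv u x - a / n.factorial * x ^ n) (Metric.ball 0 δ) x := by
      intro x hx
      have h1 := (hball x hx).hasDerivAt.sub
        ((hasDerivAt_pow (n + 1) x).const_mul (a / (n + 1).factorial))
      refine HasDerivAt.hasDerivWithinAt ?_
      refine h1.congr_deriv ?_
      simp only [Nat.factorial_succ, Nat.cast_mul, Nat.cast_add, Nat.cast_one, Nat.add_sub_cancel]
      field_simp
    have h0 : u 0 = 0 := by simpa using hz 0 (by omega)
    have := (convex_ball (0 : ℝ) δ).isLittleO_pow_succ_real (n := n) (x₀ := 0)
      (Metric.mem_ball_self hδ) hderiv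
      (by
        rw [(Metric.isOpen_ball).nhdsWithin_eq (Metric.mem_ball_self hδ)]
        simpa using key)
    rw [(Metric.isOpen_ball).nhdsWithin_eq (Metric.mem_ball_self hδ)] at this
    simpa [h0] using this

theorem FlatAtZero.isLittleO {u : ℝ → ℝ} (hflat : FlatAtZero u)
    (hu : ContDiffAt ℝ (⊤ : ℕ∞) u 0) (n : ℕ) : u =o[𝓝 0] fun x => x ^ n := by
  simpa [hflat n] using
    isLittleO_sub_monomial_of_iteratedDeriv_eq_zero n u hu fun k _ => hflat k

/-- If the leading monomial is negligible along a filter accumulating at `0`, then its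
coefficient vanishes. -/
theorem eq_zero_of_const_mul_pow_isLittleO {l : Filter ℝ} [NeBot l] (hl : l ≤ 𝓝[≠] 0) {a : ℝ}
    {n : ℕ} (h : (fun x : ℝ => a * x ^ n) =o[l] fun x => x ^ n) : a = 0 := by
  by_contra ha
  have h1 : (fun x : ℝ => x ^ n) =o[l] fun x => x ^ n := (isLittleO_const_mul_left_iff ha).1 h
  have h2 : ∀ᶠ x in l, x ≠ 0 := hl self_mem_nhdsWithin
  exact isLittleO_irrefl (h2.mono fun x hx => pow_ne_zero n hx).frequently h1

/-- A smooth function that decays faster than every power along some filter accumulating at `0`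
is flat at the origin. -/
theorem flatAtZero_of_isLittleO {l : Filter ℝ} [NeBot l] (hl : l ≤ 𝓝[≠] 0) {u : ℝ → ℝ}
    (hu : ContDiffAt ℝ (⊤ : ℕ∞) u 0) (h : ∀ n : ℕ, u =o[l] fun x => x ^ n) : FlatAtZero u := by
  intro n
  induction n using Nat.strong_induction_on with
  | _ n ih =>
    have h1 := (isLittleO_sub_monomial_of_iteratedDeriv_eq_zero n u hu ih).mono
      (hl.trans nhdsWithin_le_nhds)
    have h2 := (h n).sub h1
    simp only [sub_sub_cancel] at h2
    exact (div_eq_zero_iff.1 (eq_zero_of_const_mul_pow_isLittleO hl h2)).resolve_right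
      (by positivity)

/-- A smooth solution of `g g'² = c` up to a flat error has the Taylor series of `c`. -/
theorem flatAtZero_sub_id_of_mul_deriv_sq {g : ℝ → ℝ} (hg : ContDiffAt ℝ (⊤ : ℕ∞) g 0)
    (hg0 : g 0 = 0) (h : FlatAtZero fun c => g c * deriv g c ^ 2 - c) :
    FlatAtZero fun c => g c - c := by
  have hdg : ContDiffAt ℝ (⊤ : ℕ∞) (deriv g) 0 := hg.contDiffAt_deriv (by simp)
  have hdiff : DifferentiableAt ℝ g 0 := hg.differentiableAt (by simp)
  have hE : ContDiffAt ℝ (⊤ : ℕ∞) (fun c => g c * deriv g c ^ 2 - c) 0 :=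
    (hg.mul (hdg.pow 2)).sub contDiffAt_id
  have hw : ContDiffAt ℝ (⊤ : ℕ∞) (fun c => g c - c) 0 := hg.sub contDiffAt_id
  have hdw : deriv (fun c => g c - c) =ᶠ[𝓝 0] fun c => deriv g c - 1 := by
    filter_upwards [(hg.of_le (m := 1) (by norm_cast)).eventually (by simp)] with c hc
    have := (hc.differentiableAt (by simp)).hasDerivAt.sub (hasDerivAt_id c)
    exact this.deriv
  have hd1 : deriv g 0 = 1 := by
    have h1 := h 1
    rw [iteratedDeriv_one] at h1
    have h2 := (hdiff.hasDerivAt.mul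
      ((hdg.differentiableAt (by simp)).hasDerivAt.pow 2)).sub (hasDerivAt_id 0)
    have h3 : deriv (fun c => g c * deriv g c ^ 2 - c) 0 = _ := h2.deriv
    rw [h3] at h1
    simp only [hg0, Pi.pow_apply] at h1
    have h4 : deriv g 0 ^ 3 = 1 ^ 3 := by linear_combination h1
    exact (Odd.strictMono_pow (by decide : Odd 3)).injective h4
  intro n
  induction n using Nat.strong_induction_on with
  | _ n ih =>
    obtain rfl | rfl | hn : n = 0 ∨ n = 1 ∨ 2 ≤ n := by omega
    · simp [hg0]
    · rw [iteratedDeriv_one, hdw.eq_of_nhds, hd1, sub_self]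
    · obtain ⟨m, rfl⟩ : ∃ m, n = m + 2 := ⟨n - 2, by omega⟩
      set w : ℝ → ℝ := fun c => g c - c with hwdef
      set a := iteratedDeriv (m + 2) w 0 with ha
      have hw1 := isLittleO_sub_monomial_of_iteratedDeriv_eq_zero (m + 2) w hw ih
      have hw2 := isLittleO_sub_monomial_of_iteratedDeriv_eq_zero (m + 1) (deriv w)
        (hw.contDiffAt_deriv (by simp)) fun k hk => by
          rw [← iteratedDeriv_succ']
          exact ih (k + 1) (by omega)
      rw [← iteratedDeriv_succ', ← ha] at hw2
      rw [← ha] at hw1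
      have hdw_small : deriv w =o[𝓝 0] fun _ => (1 : ℝ) := by
        rw [isLittleO_one_iff]
        have := (hw.contDiffAt_deriv (m := 0) (by simp)).continuousAt.tendsto
        rwa [hdw.eq_of_nhds, hd1, sub_self] at this
      have hwO : w =O[𝓝 0] fun c => c ^ (m + 2) := by
        simpa using hw1.isBigO.add (isBigO_const_mul_self (a / (m + 2).factorial) _ _)
      have hdw_bigO : deriv w =O[𝓝 0] fun c => c ^ (m + 1) := by
        simpa using hw2.isBigO.add (isBigO_const_mul_self (a / (m + 1).factorial) _ _)
      have hid : (fun c : ℝ => c) =O[𝓝 0] fun c : ℝ => c := isBigO_refl _ _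
      have t1 : (fun c => c * (deriv w c - a / (m + 1).factorial * c ^ (m + 1)))
          =o[𝓝 0] fun c : ℝ => c ^ (m + 2) :=
        (hid.mul_isLittleO hw2).congr_right fun c => by ring
      have t2 : (fun c => c * (deriv w c * deriv w c)) =o[𝓝 0] fun c : ℝ => c ^ (m + 2) :=
        (hid.mul_isLittleO (hdw_bigO.mul_isLittleO hdw_small)).congr_right fun c => by ring
      have t3 : (fun c => w c * (deriv w c * 2 + deriv w c * deriv w c))
          =o[𝓝 0] fun c : ℝ => c ^ (m + 2) := by
        have h2 : (fun c => deriv w c * 2 + deriv w c * deriv w c) =o[𝓝 0] fun _ => (1 : ℝ) :=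
          (((hdw_small.const_mul_left 2).congr_left fun c => mul_comm _ _)).add
            ((hdw_small.mul hdw_small).congr_right fun c => one_mul 1)
        exact (hwO.mul_isLittleO h2).congr_right fun c => by ring
      have hsum := ((h.isLittleO hE (m + 2)).sub
        ((((t1.const_mul_left 2).add t2).add hw1).add t3)).congr'
          (f₂ := fun c => (2 * (a / (m + 1).factorial) + a / (m + 2).factorial) * c ^ (m + 2))
          (by
            filter_upwards [hdw] with c hc
            have hc' : deriv g c = 1 + deriv w c := by rw [hc]; ring
            have hgc : g c = c + w c := by simp [hwdef]
            simp only [hc', hgc]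
            ring) EventuallyEq.rfl
      have hcoef := eq_zero_of_const_mul_pow_isLittleO le_rfl (hsum.mono nhdsWithin_le_nhds)
      have hpos : 2 * (1 / ((m + 1).factorial : ℝ)) + 1 / (m + 2).factorial ≠ 0 := by positivity
      refine (mul_eq_zero.1 ?_).resolve_right hpos
      linear_combination hcoef

/-- An injective `C¹` map preserving a Haar measure has Jacobian determinant `±1`. -/
theorem abs_det_fderiv_eq_one_of_measure_image_eq {E : Type*} [NormedAddCommGroup E]
    [NormedSpace ℝ E] [FiniteDimensional ℝ E] [MeasurableSpace E] [BorelSpace E] (μ : Measure E)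
    [μ.IsAddHaarMeasure] {f : E → E} {W : Set E} (hW : IsOpen W) (hf : ContDiffOn ℝ 1 f W)
    (hinj : InjOn f W) (hμ : ∀ s, MeasurableSet s → s ⊆ W → μ (f '' s) = μ s) :
    ∀ x ∈ W, |(fderiv ℝ f x).det| = 1 := by
  have hdet : ContinuousOn (fun x => |(fderiv ℝ f x).det|) W :=
    (ContinuousLinearMap.continuous_det.comp_continuousOn
      (hf.continuousOn_fderiv_of_isOpen hW le_rfl)).abs
  have hae : (fun x => ENNReal.ofReal |(fderiv ℝ f x).det|) =ᵐ[μ.restrict W] fun _ => 1 := by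
    refine ae_eq_of_forall_setLIntegral_eq_of_sigmaFinite₀
      ((ENNReal.continuous_ofReal.comp_continuousOn hdet).aemeasurable hW.measurableSet)
      aemeasurable_const fun s hs _ => ?_
    rw [Measure.restrict_restrict hs, setLIntegral_one,
      lintegral_abs_det_fderiv_eq_addHaar_image μ (hs.inter hW.measurableSet)
        (fun x hx => (((hf.differentiableOn (by simp)).differentiableAt
          (hW.mem_nhds hx.2)).hasFDerivAt).hasFDerivWithinAt) (hinj.mono inter_subset_right),
      hμ _ (hs.inter hW.measurableSet) inter_subset_right]
  have heq := Measure.eqOn_open_of_ae_eq hae hW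
    (ENNReal.continuous_ofReal.comp_continuousOn hdet) continuousOn_const
  intro x hx
  exact ENNReal.ofReal_eq_one.1 (heq hx)

theorem ContinuousLinearMap.det_prod_real (A : ℝ × ℝ →L[ℝ] ℝ × ℝ) :
    A.det = (A (1, 0)).1 * (A (0, 1)).2 - (A (0, 1)).1 * (A (1, 0)).2 := by
  rw [ContinuousLinearMap.det, ← LinearMap.det_toMatrix (Module.Basis.finTwoProd ℝ),
    Matrix.det_fin_two]
  simp [LinearMap.toMatrix_apply]

/-- If `Φ` carries `q - p²` to a function `g` of `q - p²`, then its Jacobian determinant is `g'`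
times the derivative of its first component along the parabolas `q - p² = c`. -/
theorem hasDerivAt_fst_along_parabola {Φ : ℝ × ℝ → ℝ × ℝ} {g : ℝ → ℝ} {s c : ℝ}
    (hΦ : DifferentiableAt ℝ Φ (s, s ^ 2 + c)) (hg : DifferentiableAt ℝ g c)
    (hconj : ∀ᶠ x in 𝓝 (s, s ^ 2 + c), (Φ x).2 - (Φ x).1 ^ 2 = g (x.2 - x.1 ^ 2)) :
    ∃ d, HasDerivAt (fun t => (Φ (t, t ^ 2 + c)).1) d s ∧
      d * deriv g c = (fderiv ℝ Φ (s, s ^ 2 + c)).det := by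
  set A := fderiv ℝ Φ (s, s ^ 2 + c)
  have hA : HasFDerivAt Φ A (s, s ^ 2 + c) := hΦ.hasFDerivAt
  have hdir : ∀ v w : ℝ, (A (v, w)).2 - 2 * (Φ (s, s ^ 2 + c)).1 * (A (v, w)).1 =
      deriv g c * (w - 2 * s * v) := by
    intro v w
    have hline₁ : HasDerivAt (fun t : ℝ => s + t * v) v 0 := by
      simpa using ((hasDerivAt_id (0 : ℝ)).mul_const v).const_add s
    have hline₂ : HasDerivAt (fun t : ℝ => s ^ 2 + c + t * w) w 0 := by
      simpa using ((hasDerivAt_id (0 : ℝ)).mul_const w).const_add (s ^ 2 + c)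
    have hline := hline₁.prodMk hline₂
    have hpt : ((s + 0 * v, s ^ 2 + c + 0 * w) : ℝ × ℝ) = (s, s ^ 2 + c) := by simp
    have hcomp : HasDerivAt (fun t : ℝ => Φ (s + t * v, s ^ 2 + c + t * w)) (A (v, w)) 0 :=
      HasFDerivAt.comp_hasDerivAt 0 (by rw [hpt]; exact hA) hline
    have hcomp₁ : HasDerivAt (fun t : ℝ => (Φ (s + t * v, s ^ 2 + c + t * w)).1) (A (v, w)).1 0 :=
      (ContinuousLinearMap.fst ℝ ℝ ℝ).hasFDerivAt.comp_hasDerivAt 0 hcomp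
    have hcomp₂ : HasDerivAt (fun t : ℝ => (Φ (s + t * v, s ^ 2 + c + t * w)).2) (A (v, w)).2 0 :=
      (ContinuousLinearMap.snd ℝ ℝ ℝ).hasFDerivAt.comp_hasDerivAt 0 hcomp
    have hL := hcomp₂.sub (hcomp₁.pow 2)
    have hc : (s ^ 2 + c + 0 * w) - (s + 0 * v) ^ 2 = c := by ring
    have hR : HasDerivAt (fun t : ℝ => g ((s ^ 2 + c + t * w) - (s + t * v) ^ 2)) _ 0 :=
      HasDerivAt.comp 0 (by rw [hc]; exact hg.hasDerivAt) (hline₂.sub (hline₁.pow 2))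
    have hev : (fun t : ℝ => (Φ (s + t * v, s ^ 2 + c + t * w)).2 -
        (Φ (s + t * v, s ^ 2 + c + t * w)).1 ^ 2) =ᶠ[𝓝 0]
        fun t : ℝ => g ((s ^ 2 + c + t * w) - (s + t * v) ^ 2) := by
      have := hline.continuousAt.tendsto
      rw [hpt] at this
      exact this.eventually hconj
    have hu := (hL.congr_of_eventuallyEq hev.symm).unique hR
    simp only [zero_mul, add_zero] at hu
    norm_num at hu
    linear_combination hu
  refine ⟨(A (1, 2 * s)).1, ?_, ?_⟩
  · have hcurve : HasDerivAt (fun t : ℝ => ((t, t ^ 2 + c) : ℝ × ℝ)) (1, 2 * s) s := by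
      have h2 : HasDerivAt (fun t : ℝ => t ^ 2 + c) (2 * s) s := by
        simpa using (hasDerivAt_pow 2 s).add_const c
      exact (hasDerivAt_id s).prodMk h2
    exact (ContinuousLinearMap.fst ℝ ℝ ℝ).hasFDerivAt.comp_hasDerivAt s (hA.comp_hasDerivAt s hcurve)
  · have hlin : A (1, 2 * s) = A (1, 0) + (2 * s) • A (0, 1) := by
      rw [← map_smul, ← map_add]
      simp
    rw [ContinuousLinearMap.det_prod_real, hlin]
    have e1 := hdir 1 0
    have e2 := hdir 0 1
    simp only [Prod.fst_add, Prod.smul_fst, smul_eq_mul]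
    linear_combination (A (0, 1)).1 * e1 - (A (1, 0)).1 * e2

/-- Over a box at the origin, the first component of an area-preserving map carrying `q - p²` to
`g (q - p²)` has slope `ε / g' c` along each parabola `q - p² = c`, with a common sign `ε`. -/
theorem exists_slope_along_parabolas {Φ : ℝ × ℝ → ℝ × ℝ} {g : ℝ → ℝ} {U : Set (ℝ × ℝ)} {r : ℝ}
    (hΦ : ContDiffOn ℝ 1 Φ U) (hinj : InjOn Φ U)
    (harea : ∀ s : Set (ℝ × ℝ), MeasurableSet s → s ⊆ U → volume (Φ '' s) = volume s)
    (hbox : ∀ p q : ℝ, |p| < r → 0 ≤ q → q < r → (p, q) ∈ U ∧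
      (Φ (p, q)).2 - (Φ (p, q)).1 ^ 2 = g (q - p ^ 2) ∧ DifferentiableAt ℝ g (q - p ^ 2)) :
    ∃ ε : ℝ, ε ^ 2 = 1 ∧ ∀ a b c : ℝ, -r < a → a < b → b < r →
      (∀ s ∈ Icc a b, 0 ≤ s ^ 2 + c ∧ s ^ 2 + c < r) → (∀ s ∈ Ioo a b, 0 < s ^ 2 + c) →
      (Φ (b, b ^ 2 + c)).1 - (Φ (a, a ^ 2 + c)).1 = ε / deriv g c * (b - a) := by
  set W : Set (ℝ × ℝ) := Ioo (-r) r ×ˢ Ioo 0 r with hW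
  have hWo : IsOpen W := isOpen_Ioo.prod isOpen_Ioo
  have hWU : W ⊆ U := fun x hx => (hbox x.1 x.2 (abs_lt.2 hx.1) hx.2.1.le hx.2.2).1
  have hΦW : ContDiffOn ℝ 1 Φ W := hΦ.mono hWU
  have hdet := abs_det_fderiv_eq_one_of_measure_image_eq volume hWo hΦW (hinj.mono hWU)
    fun s hs hsW => harea s hs (hsW.trans hWU)
  have hcont : ContinuousOn (fun x => (fderiv ℝ Φ x).det) W :=
    ContinuousLinearMap.continuous_det.comp_continuousOn
      (hΦW.continuousOn_fderiv_of_isOpen hWo le_rfl)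
  obtain ⟨ε, hε, hεW⟩ : ∃ ε : ℝ, ε ^ 2 = 1 ∧ ∀ x ∈ W, (fderiv ℝ Φ x).det = ε := by
    have hsign := ((convex_Ioo (-r) r).prod (convex_Ioo 0 r)).isPreconnected.eq_or_eq_neg_of_sq_eq
      hcont (g := fun _ => (1 : ℝ)) continuousOn_const
      (fun x hx => by
        have := hdet x hx
        simp only [Pi.pow_apply]
        rw [← sq_abs, this])
      (fun _ => one_ne_zero)
    rcases hsign with h | h
    · exact ⟨1, by norm_num, h⟩
    · exact ⟨-1, by norm_num, h⟩
  refine ⟨ε, hε, fun a b c ha hab hb hcl hop => ?_⟩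
  have hεne : ε ≠ 0 := by
    rintro rfl
    norm_num at hε
  have hderiv : ∀ s ∈ Ioo a b, HasDerivAt (fun t => (Φ (t, t ^ 2 + c)).1) (ε / deriv g c) s := by
    intro s hs
    have hsW : (s, s ^ 2 + c) ∈ W :=
      ⟨⟨ha.trans hs.1, hs.2.trans hb⟩, hop s hs, (hcl s (Ioo_subset_Icc_self hs)).2⟩
    have hgd := (hbox s (s ^ 2 + c) (abs_lt.2 hsW.1) hsW.2.1.le hsW.2.2).2.2
    rw [add_sub_cancel_left] at hgd
    obtain ⟨d, hd, hdg⟩ := hasDerivAt_fst_along_parabola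
      ((hΦW.differentiableOn (by simp)).differentiableAt (hWo.mem_nhds hsW)) hgd
      ((hWo.eventually_mem hsW).mono fun x hx =>
        (hbox x.1 x.2 (abs_lt.2 hx.1) hx.2.1.le hx.2.2).2.1)
    rw [hεW _ hsW] at hdg
    have hgne : deriv g c ≠ 0 := right_ne_zero_of_mul (hdg ▸ hεne)
    rwa [← hdg, mul_div_cancel_right₀ _ hgne]
  have hcurve : ContinuousOn (fun t => (Φ (t, t ^ 2 + c)).1) (Icc a b) := by
    refine (hΦ.continuousOn.comp (f := fun t : ℝ => ((t, t ^ 2 + c) : ℝ × ℝ))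
      (by fun_prop) fun s hs => ?_).fst
    exact (hbox s (s ^ 2 + c) (abs_lt.2 ⟨ha.trans_le hs.1, hs.2.trans_lt hb⟩) (hcl s hs).1
      (hcl s hs).2).1
  obtain ⟨s, hs, hslope⟩ := exists_hasDerivAt_eq_slope _ _ hab hcurve hderiv
  rw [hslope, div_mul_cancel₀ _ (sub_ne_zero.2 hab.ne')]

/-- A smooth function vanishing on one side of the origin is flat at the origin. -/
theorem flatAtZero_of_eventuallyEq_zero {l : Filter ℝ} [NeBot l] (hl : l ≤ 𝓝[≠] 0) {u : ℝ → ℝ}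
    (hu : ContDiffAt ℝ (⊤ : ℕ∞) u 0) (h : u =ᶠ[l] 0) : FlatAtZero u :=
  flatAtZero_of_isLittleO hl hu fun _ => (isLittleO_zero _ _).congr' h.symm EventuallyEq.rfl

/-- If an area-preserving map of the half-plane carries `q - p²` to `g (q - p²)` near the origin,
then `g` has the Taylor series of the identity. -/
theorem flatAtZero_sub_id_of_area_preserving {Φ : ℝ × ℝ → ℝ × ℝ} {g : ℝ → ℝ} {U : Set (ℝ × ℝ)}
    (hg : ContDiffAt ℝ (⊤ : ℕ∞) g 0) (hg0 : g 0 = 0) (hg' : deriv g 0 ≠ 0)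
    (hU : U ∈ 𝓝[upperHalfPlane'] ((0 : ℝ), (0 : ℝ)))
    (hΦ : ContDiffOn ℝ (⊤ : ℕ∞) Φ U) (hinj : InjOn Φ U)
    (hbdry : ∀ x ∈ U, x.2 = 0 → (Φ x).2 = 0)
    (harea : ∀ s : Set (ℝ × ℝ), MeasurableSet s → s ⊆ U → volume (Φ '' s) = volume s)
    (hconj : ∀ᶠ x in 𝓝[upperHalfPlane'] ((0 : ℝ), (0 : ℝ)),
      (Φ x).2 - (Φ x).1 ^ 2 = g (x.2 - x.1 ^ 2)) :
    FlatAtZero fun c => g c - c := by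
  have hgdiff : ∀ᶠ x : ℝ × ℝ in 𝓝[upperHalfPlane'] ((0 : ℝ), (0 : ℝ)),
      DifferentiableAt ℝ g (x.2 - x.1 ^ 2) := by
    have h1 : ∀ᶠ c in 𝓝 (0 : ℝ), DifferentiableAt ℝ g c :=
      ((hg.of_le (m := 1) (by norm_cast)).eventually (by simp)).mono
        fun c hc => hc.differentiableAt (by simp)
    have h2 : Tendsto (fun x : ℝ × ℝ => x.2 - x.1 ^ 2) (𝓝 ((0 : ℝ), (0 : ℝ))) (𝓝 0) := by
      have : Continuous fun x : ℝ × ℝ => x.2 - x.1 ^ 2 := by fun_prop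
      simpa using this.tendsto ((0 : ℝ), (0 : ℝ))
    exact (h2.eventually h1).filter_mono nhdsWithin_le_nhds
  obtain ⟨r, hr, hr1, hbox⟩ : ∃ r : ℝ, 0 < r ∧ r ≤ 1 ∧
      ∀ p q : ℝ, |p| < r → 0 ≤ q → q < r → (p, q) ∈ U ∧
        (Φ (p, q)).2 - (Φ (p, q)).1 ^ 2 = g (q - p ^ 2) ∧ DifferentiableAt ℝ g (q - p ^ 2) := by
    obtain ⟨ρ, hρ, hsub⟩ := Metric.mem_nhdsWithin_iff.1
      (inter_mem hU (inter_mem hconj hgdiff))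
    refine ⟨min ρ 1, lt_min hρ one_pos, min_le_right _ _, fun p q hp hq0 hq => ?_⟩
    have hmem : ((p, q) : ℝ × ℝ) ∈ Metric.ball ((0 : ℝ), (0 : ℝ)) ρ ∩ upperHalfPlane' := by
      refine ⟨?_, hq0⟩
      rw [Metric.mem_ball, Prod.dist_eq, max_lt_iff, Real.dist_0_eq_abs, Real.dist_0_eq_abs,
        abs_of_nonneg hq0]
      exact ⟨hp.trans_le (min_le_left _ _), hq.trans_le (min_le_left _ _)⟩
    exact hsub hmem
  obtain ⟨ε, hε, hslope⟩ := exists_slope_along_parabolas (hΦ.of_le (by norm_cast)) hinj harea hbox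
  set b := r / 2 with hb
  have hb0 : 0 < b := by positivity
  have hbr : b < r := by linarith
  have hb2 : b ^ 2 ≤ b / 2 := by nlinarith
  have hdg : ContDiffAt ℝ (⊤ : ℕ∞) (deriv g) 0 := hg.contDiffAt_deriv (by simp)
  have hk : ContDiffAt ℝ (⊤ : ℕ∞) (fun c => ε / deriv g c) 0 := contDiffAt_const.div hdg hg'
  have hsec : ∀ p : ℝ, p ^ 2 = b ^ 2 →
      ContDiffAt ℝ (⊤ : ℕ∞) (fun c => (Φ (p, p ^ 2 + c)).1) 0 := by
    intro p hp
    have hp' : |p| < r := by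
      rw [(sq_eq_sq_iff_abs_eq_abs p b).1 hp, abs_of_pos hb0]
      exact hbr
    have hWo : IsOpen (Ioo (-r) r ×ˢ Ioo 0 r) := isOpen_Ioo.prod isOpen_Ioo
    have hU' : U ∈ 𝓝 (p, p ^ 2 + 0) := by
      refine Filter.mem_of_superset (hWo.mem_nhds ⟨abs_lt.1 hp', ?_, ?_⟩)
        fun x hx => (hbox x.1 x.2 (abs_lt.2 hx.1) hx.2.1.le hx.2.2).1
      · simp only [hp, add_zero]; positivity
      · simp only [hp, add_zero]; linarith
    exact ((hΦ.contDiffAt hU').comp (0 : ℝ)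
      (contDiffAt_const.prodMk (contDiffAt_const.add contDiffAt_id))).fst
  set h₁ : ℝ → ℝ := fun c => (Φ (b, b ^ 2 + c)).1 - ε / deriv g c * b with hh₁
  set h₂ : ℝ → ℝ := fun c => (Φ (-b, (-b) ^ 2 + c)).1 + ε / deriv g c * b with hh₂
  have hs₁ : ContDiffAt ℝ (⊤ : ℕ∞) h₁ 0 := (hsec b rfl).sub (hk.mul contDiffAt_const)
  have hs₂ : ContDiffAt ℝ (⊤ : ℕ∞) h₂ 0 :=
    (hsec (-b) (neg_sq b)).add (hk.mul contDiffAt_const)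
  have hdiff : ∀ᶠ c in 𝓝[>] (0 : ℝ), h₁ c - h₂ c = 0 := by
    filter_upwards [Ioo_mem_nhdsGT hb0] with c hc
    have := hslope (-b) b c (by linarith) (by linarith) hbr
      (fun s hs => ⟨by nlinarith [hc.1], by nlinarith [hs.1, hs.2, hc.2]⟩)
      (fun s _ => by nlinarith [hc.1])
    simp only [hh₁, hh₂]
    linear_combination this
  have hneg : ∀ᶠ c in 𝓝[<] (0 : ℝ), h₁ c + h₂ c = 0 ∧
      -g c = (h₁ c + ε / deriv g c * √(-c)) ^ 2 := by
    have hb2pos : -b ^ 2 < 0 := by nlinarith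
    filter_upwards [Ioo_mem_nhdsLT hb2pos] with c hc
    set p := √(-c) with hp
    have hp2 : p ^ 2 = -c := Real.sq_sqrt (by linarith [hc.2])
    have hp0 : 0 < p := Real.sqrt_pos.2 (by linarith [hc.2])
    have hpb : p < b := by nlinarith [hc.1]
    have hright := hslope p b c (by linarith) hpb hbr
      (fun s hs => ⟨by nlinarith [hs.1], by nlinarith [hs.1, hs.2, hc.2]⟩)
      (fun s hs => by nlinarith [hs.1])
    have hleft := hslope (-b) (-p) c (by linarith) (by linarith) (by linarith)
      (fun s hs => ⟨by nlinarith [hs.2], by nlinarith [hs.1, hs.2, hc.2]⟩)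
      (fun s hs => by nlinarith [hs.2])
    have e1 : p ^ 2 + c = 0 := by linarith
    have e2 : (-p) ^ 2 + c = 0 := by linarith [neg_sq p]
    rw [e1] at hright
    rw [e2] at hleft
    have habs : |p| < r := by rw [abs_of_pos hp0]; linarith
    obtain ⟨hU₁, hc₁, -⟩ := hbox p 0 habs le_rfl hr
    obtain ⟨hU₂, hc₂, -⟩ := hbox (-p) 0 (by rwa [abs_neg]) le_rfl hr
    rw [hbdry _ hU₁ rfl, show (0 : ℝ) - p ^ 2 = c by linarith] at hc₁
    rw [hbdry _ hU₂ rfl, show (0 : ℝ) - (-p) ^ 2 = c by linarith] at hc₂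
    have hne : (Φ (p, 0)).1 ≠ (Φ (-p, 0)).1 := by
      intro heq
      have := hinj hU₁ hU₂ (Prod.ext heq (by rw [hbdry _ hU₁ rfl, hbdry _ hU₂ rfl]))
      have := congrArg Prod.fst this
      simp only at this
      linarith
    have hsum : (Φ (p, 0)).1 + (Φ (-p, 0)).1 = 0 := by
      have : ((Φ (p, 0)).1 - (Φ (-p, 0)).1) * ((Φ (p, 0)).1 + (Φ (-p, 0)).1) = 0 := by
        linear_combination hc₂ - hc₁
      exact (mul_eq_zero.1 this).resolve_left (sub_ne_zero.2 hne)
    have hφ : (Φ (p, 0)).1 = h₁ c + ε / deriv g c * p := by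
      simp only [hh₁]
      linear_combination -hright
    refine ⟨?_, ?_⟩
    · simp only [hh₁, hh₂]
      linear_combination hsum + hright - hleft
    · rw [← hφ]
      linear_combination hc₁
  have hgt : 𝓝[>] (0 : ℝ) ≤ 𝓝[≠] 0 := nhdsWithin_mono _ fun x hx => ne_of_gt hx
  have hlt : 𝓝[<] (0 : ℝ) ≤ 𝓝[≠] 0 := nhdsWithin_mono _ fun x hx => ne_of_lt hx
  have hD := flatAtZero_of_eventuallyEq_zero hgt (hs₁.sub hs₂) hdiff
  have hS := flatAtZero_of_eventuallyEq_zero hlt (hs₁.add hs₂) (hneg.mono fun c hc => hc.1)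
  have hh : ∀ n : ℕ, h₁ =o[𝓝 0] fun c => c ^ n := fun n =>
    (((hD.isLittleO (hs₁.sub hs₂) n).add (hS.isLittleO (hs₁.add hs₂) n)).const_mul_left
      (1 / 2)).congr_left fun c => by ring
  refine flatAtZero_sub_id_of_mul_deriv_sq hg hg0
    (flatAtZero_of_isLittleO hlt ((hg.mul (hdg.pow 2)).sub contDiffAt_id) fun n => ?_)
  have hbdd : (fun c => -(deriv g c * (h₁ c * deriv g c + 2 * ε * √(-c)))) =O[𝓝 0]
      fun _ => (1 : ℝ) := by
    have h1 := hdg.continuousAt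
    have h2 := hs₁.continuousAt
    have h3 : ContinuousAt (fun c => -(deriv g c * (h₁ c * deriv g c + 2 * ε * √(-c)))) 0 := by
      fun_prop
    exact h3.tendsto.isBigO_one ℝ
  have hprod := (((hh n).mul_isBigO hbdd).congr_right fun c => mul_one _).mono
    (nhdsWithin_le_nhds (s := Iio (0 : ℝ)))
  refine hprod.congr' ?_ EventuallyEq.rfl
  filter_upwards [hneg, self_mem_nhdsWithin,
    (hdg.continuousAt.eventually_ne hg').filter_mono nhdsWithin_le_nhds] with c hc hc0 hgc
  have hp2 : √(-c) ^ 2 = -c := Real.sq_sqrt (neg_nonneg.2 (le_of_lt hc0))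
  have hk : ε / deriv g c * deriv g c = ε := div_mul_cancel₀ _ hgc
  have hmul : -g c * deriv g c ^ 2 = (h₁ c * deriv g c + ε * √(-c)) ^ 2 := by
    rw [hc.2, ← mul_pow, add_mul, mul_right_comm, hk]
  linear_combination hmul + ε ^ 2 * hp2 - c * hε

/-- Two smooth germs with nonzero derivative and the same value at `0` differ by a local
reparametrization. -/
theorem exists_local_reparametrization {lam lamt : ℝ → ℝ}
    (hlam : ContDiffAt ℝ (⊤ : ℕ∞) lam 0) (hlamt : ContDiffAt ℝ (⊤ : ℕ∞) lamt 0)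
    (h0 : lam 0 = lamt 0) (hlam' : deriv lam 0 ≠ 0) (hlamt' : deriv lamt 0 ≠ 0) :
    ∃ g : ℝ → ℝ, ContDiffAt ℝ (⊤ : ℕ∞) g 0 ∧ g 0 = 0 ∧ deriv g 0 ≠ 0 ∧
      (∀ᶠ c in 𝓝 0, lamt (g c) = lam c) ∧
      ∀ᶠ y in 𝓝 0, ∀ c, lamt y = lam c → y = g c := by
  have hd : HasFDerivAt lamt
      ((ContinuousLinearEquiv.unitsEquivAut ℝ (Units.mk0 _ hlamt') : ℝ ≃L[ℝ] ℝ) : ℝ →L[ℝ] ℝ) 0 :=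
    ((hlamt.hasStrictDerivAt (by simp)).hasStrictFDerivAt_equiv hlamt').hasFDerivAt
  have hne : ((⊤ : ℕ∞) : WithTop ℕ∞) ≠ 0 := by simp
  have hs := hlamt.hasStrictFDerivAt' hd hne
  set v := hlamt.localInverse hd hne
  have hv : ContDiffAt ℝ (⊤ : ℕ∞) v (lam 0) := h0 ▸ hlamt.to_localInverse hd hne
  have hg : ContDiffAt ℝ (⊤ : ℕ∞) (fun c => v (lam c)) 0 := hv.comp 0 hlam
  have hg0 : v (lam 0) = 0 := h0 ▸ hlamt.localInverse_apply_image hd hne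
  have hright : ∀ᶠ c in 𝓝 0, lamt (v (lam c)) = lam c :=
    hlam.continuousAt.eventually (h0 ▸ hs.eventually_right_inverse)
  refine ⟨fun c => v (lam c), hg, hg0, fun hz => hlam' ?_, hright,
    hs.eventually_left_inverse.mono fun y hy c hc => ?_⟩
  · have h1 : HasDerivAt lamt (deriv lamt 0) (v (lam 0)) := by
      rw [hg0]
      exact (hlamt.differentiableAt (by simp)).hasDerivAt
    have h2 := h1.comp 0 (hg.differentiableAt (by simp)).hasDerivAt
    rw [hz, mul_zero] at h2
    exact (h2.congr_of_eventuallyEq (hright.mono fun c hc => hc.symm)).deriv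
  · exact hy.symm.trans (congrArg v hc)

theorem boundary_hyperbolic_normal_form_uniqueness
    (lam lamt : ℝ → ℝ)
    (hlam : ContDiff ℝ (⊤ : ℕ∞) lam) (hlamt : ContDiff ℝ (⊤ : ℕ∞) lamt)
    (hlam0 : lam 0 = 0) (hlamt0 : lamt 0 = 0)
    (hlam' : deriv lam 0 ≠ 0) (hlamt' : deriv lamt 0 ≠ 0)
    (U V : Set (ℝ × ℝ))
    (hUsub : U ⊆ upperHalfPlane') (hVsub : V ⊆ upperHalfPlane')
    (hU : U ∈ nhdsWithin ((0 : ℝ), (0 : ℝ)) upperHalfPlane')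
    (hV : V ∈ nhdsWithin ((0 : ℝ), (0 : ℝ)) upperHalfPlane')
    (Φ Ψ : ℝ × ℝ → ℝ × ℝ)
    (hΦsmooth : ContDiffOn ℝ (⊤ : ℕ∞) Φ U) (hΨsmooth : ContDiffOn ℝ (⊤ : ℕ∞) Ψ V)
    (hΦbij : Set.BijOn Φ U V) (hΨinv : Set.InvOn Ψ Φ U V)
    (hΦ0 : Φ (0, 0) = (0, 0))
    (hΦbdry : ∀ x ∈ U, x.2 = 0 → (Φ x).2 = 0)
    (hΦarea : ∀ s : Set (ℝ × ℝ), MeasurableSet s → s ⊆ U → volume (Φ '' s) = volume s)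
    (hconj : ∀ x ∈ U, lamt ((Φ x).2 - (Φ x).1 ^ 2) = lam (x.2 - x.1 ^ 2)) :
    FlatAtZero (fun x => lam x - lamt x) := by
  obtain ⟨g, hg, hg0, hg', hright, hleft⟩ := exists_local_reparametrization hlam.contDiffAt
    hlamt.contDiffAt (hlam0.trans hlamt0.symm) hlam' hlamt'
  have h0U : ((0 : ℝ), (0 : ℝ)) ∈ U := mem_of_mem_nhdsWithin (show (0 : ℝ) ≤ 0 from le_rfl) hU
  have hconj' : ∀ᶠ x in 𝓝[upperHalfPlane'] ((0 : ℝ), (0 : ℝ)),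
      (Φ x).2 - (Φ x).1 ^ 2 = g (x.2 - x.1 ^ 2) := by
    have hcont : Tendsto Φ (𝓝[upperHalfPlane'] ((0 : ℝ), (0 : ℝ))) (𝓝 (0, 0)) := by
      have h1 := hΦsmooth.continuousOn _ h0U
      rw [ContinuousWithinAt, hΦ0] at h1
      exact h1.mono_left (nhdsWithin_le_iff.2 hU)
    have hF : Tendsto (fun x : ℝ × ℝ => x.2 - x.1 ^ 2) (𝓝 ((0 : ℝ), (0 : ℝ))) (𝓝 0) := by
      have : Continuous fun x : ℝ × ℝ => x.2 - x.1 ^ 2 := by fun_prop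
      simpa using this.tendsto ((0 : ℝ), (0 : ℝ))
    filter_upwards [hU, (hF.comp hcont).eventually hleft] with x hxU hx
    exact hx _ (hconj x hxU)
  have hflat := flatAtZero_sub_id_of_area_preserving hg hg0 hg' hU hΦsmooth hΦbij.injOn hΦbdry
    hΦarea hconj'
  refine flatAtZero_of_isLittleO le_rfl (hlam.sub hlamt).contDiffAt fun n => ?_
  have hlip := (hlamt.contDiffAt.hasStrictDerivAt (x := 0) (by simp)).hasStrictFDerivAt.isBigO_sub
  have hpair : Tendsto (fun c => (g c, c)) (𝓝 0) (𝓝 ((0 : ℝ), (0 : ℝ))) := by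
    have := hg.continuousAt.tendsto.prodMk_nhds (tendsto_id (α := ℝ) (x := 𝓝 0))
    rwa [hg0] at this
  have hO := (hlip.comp_tendsto hpair).trans_isLittleO
    (hflat.isLittleO (hg.sub contDiffAt_id) n)
  refine (hO.congr' (hright.mono fun c hc => ?_) EventuallyEq.rfl).mono nhdsWithin_le_nhds
  simp only [Function.comp_apply, hc]
end

section
/- Let ψ : ℝ → ℝ be a C^∞ function that is flat at the origin. Then there exist neighborhoods U and V of the origin in the closed upper half-plane H = {(p,q) ∈ ℝ² : q ≥ 0} and a C^∞ diffeomorphism Φ = (Φ₁, Φ₂) : U → V such that Φ(0,0) = (0,0), Φ maps U ∩ {q = 0} into {q = 0}, Φ preserves the area form dp ∧ dq (the Jacobian determinant of Φ equals 1 on U), and Φ₂(p,q) − Φ₁(p,q)² = (q − p²) + ψ(q − p²) for all (p,q) ∈ U. -/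
open MeasureTheory Set

section FlatFunctions

open Filter Topology Asymptotics

theorem FlatAtZero.deriv {u : ℝ → ℝ} (hu : FlatAtZero u) : FlatAtZero (deriv u) := fun n => by
  rw [← iteratedDeriv_succ']
  exact hu (n + 1)

theorem FlatAtZero.isLittleO_pow {u : ℝ → ℝ} (hu : ContDiff ℝ (⊤ : ℕ∞) u) (hflat : FlatAtZero u)
    (n : ℕ) : u =o[𝓝 0] fun t => t ^ n := by
  have h := taylor_isLittleO_univ (x₀ := 0) (hu.of_le (mod_cast le_top) : ContDiff ℝ n u)
  have h0 : ∀ k, iteratedDerivWithin k u univ 0 = 0 := fun k => by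
    rw [iteratedDerivWithin_univ]; exact hflat k
  simpa [taylor_within_apply, h0] using h

/-- The function `t ↦ (-t) ^ r * u t` on the negative half-line, extended by zero. -/
noncomputable def negRpowMul (r : ℝ) (u : ℝ → ℝ) (t : ℝ) : ℝ :=
  if t < 0 then (-t) ^ r * u t else 0

theorem negRpowMul_of_neg {r t : ℝ} (u : ℝ → ℝ) (ht : t < 0) :
    negRpowMul r u t = (-t) ^ r * u t := if_pos ht

theorem negRpowMul_of_nonneg {r t : ℝ} (u : ℝ → ℝ) (ht : 0 ≤ t) :
    negRpowMul r u t = 0 := if_neg ht.not_gt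

theorem hasDerivAt_negRpowMul {u : ℝ → ℝ} (hu : ContDiff ℝ (⊤ : ℕ∞) u) (hflat : FlatAtZero u)
    (r t : ℝ) :
    HasDerivAt (negRpowMul r u) (negRpowMul r (deriv u) t - r * negRpowMul (r - 1) u t) t := by
  rcases lt_trichotomy t 0 with ht | rfl | ht
  · have hd : HasDerivAt (fun s : ℝ => (-s) ^ r * u s)
        ((-1 * r * (-t) ^ (r - 1)) * u t + (-t) ^ r * deriv u t) t :=
      ((hasDerivAt_neg t).rpow_const (Or.inl (by linarith))).mul
        ((hu.differentiable (by simp)) t).hasDerivAt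
    rw [negRpowMul_of_neg _ ht, negRpowMul_of_neg _ ht]
    have he : negRpowMul r u =ᶠ[𝓝 t] fun s => (-s) ^ r * u s := by
      filter_upwards [Iio_mem_nhds ht] with s hs using negRpowMul_of_neg u hs
    exact (hd.congr_of_eventuallyEq he).congr_deriv (by ring)
  · simp only [negRpowMul_of_nonneg _ le_rfl, mul_zero, sub_zero]
    rw [hasDerivAt_iff_isLittleO_nhds_zero]
    obtain ⟨n, hn⟩ := exists_nat_ge (1 - r)
    have hO : (fun t => negRpowMul r u t) =O[𝓝 0] fun t => t ^ (-(n : ℤ)) * u t * t := by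
      refine IsBigO.of_bound 1 ?_
      filter_upwards [Ioo_mem_nhds (show (-1 : ℝ) < 0 by norm_num) one_pos] with t ht
      rcases lt_or_ge t 0 with h | h
      · rw [negRpowMul_of_neg _ h, one_mul, norm_mul, norm_mul, norm_mul, mul_right_comm]
        refine mul_le_mul_of_nonneg_right ?_ (norm_nonneg _)
        have ht0 : 0 < -t := by linarith
        rw [Real.norm_of_nonneg (Real.rpow_nonneg ht0.le _), norm_zpow, Real.norm_eq_abs,
          abs_of_neg h, ← Real.rpow_intCast, ← Real.rpow_add_one ht0.ne']
        refine Real.rpow_le_rpow_of_exponent_ge ht0 (by linarith [ht.1]) ?_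
        push_cast
        linarith
      · rw [negRpowMul_of_nonneg _ h]
        simp only [norm_zero]
        positivity
    have ho : (fun t => t ^ (-(n : ℤ)) * u t * t) =o[𝓝 0] fun t => t := by
      have h1 : (fun t => t ^ (-(n : ℤ)) * u t) =o[𝓝 0] fun _ => (1 : ℝ) := by
        have h2 := (isBigO_refl (fun t : ℝ => t ^ (-(n : ℤ))) (𝓝 0)).mul_isLittleO
          (hflat.isLittleO_pow hu n)
        refine h2.trans_isBigO (IsBigO.of_bound 1 (Eventually.of_forall fun t => ?_))
        rcases eq_or_ne t 0 with rfl | h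
        · rcases n with _ | n <;> simp
        · simp [h]
      simpa using h1.mul_isBigO (isBigO_refl (fun t : ℝ => t) (𝓝 0))
    simpa [negRpowMul_of_nonneg] using hO.trans_isLittleO ho
  · rw [negRpowMul_of_nonneg _ ht.le, negRpowMul_of_nonneg _ ht.le, mul_zero, sub_zero]
    refine (hasDerivAt_const t (0 : ℝ)).congr_of_eventuallyEq ?_
    filter_upwards [Ioi_mem_nhds ht] with s hs using negRpowMul_of_nonneg u (le_of_lt hs)

theorem contDiff_negRpowMul {u : ℝ → ℝ} (hu : ContDiff ℝ (⊤ : ℕ∞) u) (hflat : FlatAtZero u)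
    (r : ℝ) : ContDiff ℝ (⊤ : ℕ∞) (negRpowMul r u) := by
  refine contDiff_infty.2 fun n => ?_
  induction n generalizing u r with
  | zero =>
    exact contDiff_zero.2 (continuous_iff_continuousAt.2 fun t =>
      (hasDerivAt_negRpowMul hu hflat r t).continuousAt)
  | succ n ih =>
    have hd : deriv (negRpowMul r u) =
        fun t => negRpowMul r (deriv u) t - r * negRpowMul (r - 1) u t :=
      funext fun t => (hasDerivAt_negRpowMul hu hflat r t).deriv
    have hu' : ContDiff ℝ (⊤ : ℕ∞) (deriv u) := (contDiff_infty_iff_deriv.1 hu).2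
    push_cast
    refine contDiff_succ_iff_deriv.2
      ⟨fun t => (hasDerivAt_negRpowMul hu hflat r t).differentiableAt, by simp, ?_⟩
    rw [hd]
    exact (ih hu' hflat.deriv r).sub (contDiff_const.mul (ih hu hflat (r - 1)))

end FlatFunctions

section OddLift

open Filter Topology

/-- The coordinate `q - p ^ 2` whose level sets are the leaves of the normal form. -/
def leafCoord (x : ℝ × ℝ) : ℝ := x.2 - x.1 ^ 2

/-- The union of the leaves in the closed upper half-plane with coordinate in `I`. -/
def leafRegion (I : Set ℝ) : Set (ℝ × ℝ) := {x | 0 ≤ x.2 ∧ leafCoord x ∈ I}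

/-- The function `a (q - p ^ 2)`, with its sign reversed on the left half-plane. -/
noncomputable def oddLift (a : ℝ → ℝ) (x : ℝ × ℝ) : ℝ :=
  if 0 < x.1 then a (leafCoord x) else -a (leafCoord x)

/-- The differential of `leafCoord`. -/
noncomputable def leafCoordDeriv (x : ℝ × ℝ) : ℝ × ℝ →L[ℝ] ℝ :=
  ContinuousLinearMap.snd ℝ ℝ ℝ - (2 * x.1) • ContinuousLinearMap.fst ℝ ℝ ℝ

theorem contDiff_leafCoord {n : WithTop ℕ∞} : ContDiff ℝ n leafCoord :=
  contDiff_snd.sub (contDiff_fst.pow 2)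

theorem contDiff_leafCoordDeriv {n : WithTop ℕ∞} : ContDiff ℝ n leafCoordDeriv :=
  contDiff_const.sub ((contDiff_const.mul contDiff_fst).smul contDiff_const)

theorem hasFDerivAt_leafCoord (x : ℝ × ℝ) : HasFDerivAt leafCoord (leafCoordDeriv x) x := by
  have h := (hasFDerivAt_snd (𝕜 := ℝ) (p := x)).sub ((hasFDerivAt_fst (𝕜 := ℝ) (p := x)).pow 2)
  refine h.congr_fderiv ?_
  simp [leafCoordDeriv]

theorem hasFDerivAt_comp_leafCoord {a : ℝ → ℝ} {x : ℝ × ℝ}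
    (ha : DifferentiableAt ℝ a (leafCoord x)) :
    HasFDerivAt (fun y => a (leafCoord y)) (deriv a (leafCoord x) • leafCoordDeriv x) x :=
  ha.hasDerivAt.comp_hasFDerivAt x (hasFDerivAt_leafCoord x)

theorem leafCoord_nonneg_of_fst_eq_zero {x : ℝ × ℝ} (hx : 0 ≤ x.2) (h : x.1 = 0) :
    0 ≤ leafCoord x := by
  simpa [leafCoord, h] using hx

theorem deriv_eq_zero_of_eq_zero_of_nonneg {I : Set ℝ} (hI : IsOpen I) {a : ℝ → ℝ}
    (ha : DifferentiableOn ℝ a I) (ha0 : ∀ t ∈ I, 0 ≤ t → a t = 0) :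
    ∀ t ∈ I, 0 ≤ t → deriv a t = 0 := fun t ht h0 => by
  have hd := ((ha t ht).differentiableAt (hI.mem_nhds ht)).hasDerivAt.hasDerivWithinAt (s := Ici t)
  have hz : HasDerivWithinAt a 0 (Ici t) t := by
    refine (hasDerivWithinAt_const t (Ici t) (0 : ℝ)).congr_of_eventuallyEq ?_ (ha0 t ht h0)
    filter_upwards [self_mem_nhdsWithin, mem_nhdsWithin_of_mem_nhds (hI.mem_nhds ht)]
      with s hs hsI using ha0 s hsI (h0.trans hs)
  exact (uniqueDiffOn_Ici t t self_mem_Ici).eq_deriv _ hd hz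

theorem hasFDerivAt_oddLift {I : Set ℝ} (hI : IsOpen I) {a : ℝ → ℝ}
    (ha : DifferentiableOn ℝ a I) (ha0 : ∀ t ∈ I, 0 ≤ t → a t = 0) {x : ℝ × ℝ}
    (hx : x ∈ leafRegion I) :
    HasFDerivAt (oddLift a) (oddLift (deriv a) x • leafCoordDeriv x) x := by
  have hd := hasFDerivAt_comp_leafCoord ((ha _ hx.2).differentiableAt (hI.mem_nhds hx.2))
  rcases lt_trichotomy x.1 0 with h | h | h
  · have he : oddLift a =ᶠ[𝓝 x] fun y => -a (leafCoord y) := by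
      filter_upwards [continuous_fst.continuousAt.eventually (Iio_mem_nhds h)] with y hy
      exact if_neg (not_lt.2 (le_of_lt hy))
    refine (hd.neg.congr_of_eventuallyEq he).congr_fderiv ?_
    rw [oddLift, if_neg h.not_gt]
    exact (neg_smul _ _).symm
  · have ht := leafCoord_nonneg_of_fst_eq_zero hx.1 h
    have hx0 : oddLift a x = 0 := by simp [oddLift, ha0 _ hx.2 ht]
    have hz := deriv_eq_zero_of_eq_zero_of_nonneg hI ha ha0 _ hx.2 ht
    have hx0' : oddLift (deriv a) x = 0 := by simp [oddLift, hz]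
    rw [hx0', zero_smul]
    rw [hz, zero_smul] at hd
    refine .of_isLittleO ?_
    refine hd.isLittleO.norm_left.congr' (Eventually.of_forall fun y => ?_) .rfl |>.of_norm_left
    simp only [ha0 _ hx.2 ht, zero_apply, sub_zero, oddLift]
    split_ifs <;> simp
  · have he : oddLift a =ᶠ[𝓝 x] fun y => a (leafCoord y) := by
      filter_upwards [continuous_fst.continuousAt.eventually (Ioi_mem_nhds h)] with y hy
      exact if_pos hy
    refine (hd.congr_of_eventuallyEq he).congr_fderiv ?_
    rw [oddLift, if_pos h]

theorem contDiffOn_oddLift {I : Set ℝ} (hI : IsOpen I) {a : ℝ → ℝ}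
    (ha : ContDiffOn ℝ (⊤ : ℕ∞) a I) (ha0 : ∀ t ∈ I, 0 ≤ t → a t = 0) :
    ContDiffOn ℝ (⊤ : ℕ∞) (oddLift a) (leafRegion I) := by
  refine contDiffOn_infty.2 fun n => ?_
  induction n generalizing a with
  | zero =>
    exact contDiffOn_zero.2 fun x hx => (hasFDerivAt_oddLift hI
      (ha.differentiableOn (by simp)) ha0 hx).continuousAt.continuousWithinAt
  | succ n ih =>
    have hd := ha.differentiableOn (by simp)
    push_cast
    refine (contDiffOn_succ_iff_hasFDerivWithinAt (by simp)).2 fun x hx =>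
      ⟨leafRegion I, ?_, by simp, fun y => oddLift (deriv a) y • leafCoordDeriv y,
        fun y hy => (hasFDerivAt_oddLift hI hd ha0 hy).hasFDerivWithinAt, ?_⟩
    · rw [insert_eq_of_mem hx]
      exact self_mem_nhdsWithin
    · exact (ih ((contDiffOn_infty_iff_deriv_of_isOpen hI).1 ha).2
        (deriv_eq_zero_of_eq_zero_of_nonneg hI hd ha0)).smul contDiff_leafCoordDeriv.contDiffOn

end OddLift

section NormalFormMap

/-- The displacement on the leaf with coordinate `t` needed to match boundary points. -/
noncomputable def boundaryShift (f b : ℝ → ℝ) (t : ℝ) : ℝ := √(-f t) - b t * √(-t)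

/-- The first component of `normalFormMap`. -/
noncomputable def normalFormFst (f b : ℝ → ℝ) (x : ℝ × ℝ) : ℝ :=
  x.1 * b (leafCoord x) + oddLift (boundaryShift f b) x

/-- The map acting by `f` on the leaf coordinate, and affinely with slope `b` along the leaves,
which preserves the boundary of the half-plane. -/
noncomputable def normalFormMap (f b : ℝ → ℝ) (x : ℝ × ℝ) : ℝ × ℝ :=
  (normalFormFst f b x, f (leafCoord x) + normalFormFst f b x ^ 2)

theorem leafCoord_normalFormMap (f b : ℝ → ℝ) (x : ℝ × ℝ) :
    leafCoord (normalFormMap f b x) = f (leafCoord x) := by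
  simp [leafCoord, normalFormMap]

theorem normalFormFst_of_pos (f b : ℝ → ℝ) {x : ℝ × ℝ} (h : 0 < x.1) :
    normalFormFst f b x =
      b (leafCoord x) * (x.1 - √(-leafCoord x)) + √(-f (leafCoord x)) := by
  rw [normalFormFst, oddLift, if_pos h, boundaryShift]
  ring

theorem normalFormFst_of_nonpos (f b : ℝ → ℝ) {x : ℝ × ℝ} (h : x.1 ≤ 0) :
    normalFormFst f b x =
      -(b (leafCoord x) * (-x.1 - √(-leafCoord x)) + √(-f (leafCoord x))) := by
  rw [normalFormFst, oddLift, if_neg h.not_gt, boundaryShift]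
  ring

theorem sqrt_neg_leafCoord_le {x : ℝ × ℝ} (hx : 0 ≤ x.2) : √(-leafCoord x) ≤ |x.1| := by
  rw [← Real.sqrt_sq_eq_abs]
  exact Real.sqrt_le_sqrt (by simp [leafCoord, hx])

theorem sqrt_neg_leafCoord_eq {x : ℝ × ℝ} (hx : x.2 = 0) : √(-leafCoord x) = |x.1| := by
  rw [← Real.sqrt_sq_eq_abs]
  simp [leafCoord, hx]

theorem abs_normalFormFst {f b : ℝ → ℝ} {x : ℝ × ℝ} (hx : 0 ≤ x.2) (hb : 0 < b (leafCoord x)) :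
    |normalFormFst f b x| =
      b (leafCoord x) * (|x.1| - √(-leafCoord x)) + √(-f (leafCoord x)) := by
  have h0 : 0 ≤ b (leafCoord x) * (|x.1| - √(-leafCoord x)) + √(-f (leafCoord x)) :=
    add_nonneg (mul_nonneg hb.le (sub_nonneg.2 (sqrt_neg_leafCoord_le hx))) (Real.sqrt_nonneg _)
  rcases lt_or_ge 0 x.1 with h | h
  · rw [abs_of_pos h] at h0 ⊢
    rw [normalFormFst_of_pos f b h, abs_of_nonneg h0]
  · rw [abs_of_nonpos h] at h0 ⊢
    rw [normalFormFst_of_nonpos f b h, abs_neg, abs_of_nonneg h0]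

theorem normalFormFst_pos_iff {f b : ℝ → ℝ} {x : ℝ × ℝ} (hx : 0 ≤ x.2)
    (hb : 0 < b (leafCoord x)) (hf : leafCoord x < 0 → f (leafCoord x) < 0) :
    0 < normalFormFst f b x ↔ 0 < x.1 := by
  have hle := sqrt_neg_leafCoord_le hx
  have hS := Real.sqrt_nonneg (-f (leafCoord x))
  constructor
  · contrapose!
    intro h
    rw [normalFormFst_of_nonpos f b h, Left.neg_nonpos_iff]
    rw [abs_of_nonpos h] at hle
    exact add_nonneg (mul_nonneg hb.le (sub_nonneg.2 hle)) hS
  · intro h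
    rw [normalFormFst_of_pos f b h]
    rw [abs_of_pos h] at hle
    rcases lt_or_ge (leafCoord x) 0 with ht | ht
    · exact add_pos_of_nonneg_of_pos (mul_nonneg hb.le (sub_nonneg.2 hle))
        (Real.sqrt_pos.2 (neg_pos.2 (hf ht)))
    · rw [Real.sqrt_eq_zero_of_nonpos (neg_nonpos.2 ht), sub_zero]
      exact add_pos_of_pos_of_nonneg (mul_pos hb h) hS

theorem normalFormMap_snd_nonneg {f b : ℝ → ℝ} {x : ℝ × ℝ} (hx : 0 ≤ x.2)
    (hb : 0 < b (leafCoord x)) : 0 ≤ (normalFormMap f b x).2 := by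
  have h : √(-f (leafCoord x)) ≤ |normalFormFst f b x| := by
    rw [abs_normalFormFst hx hb]
    exact le_add_of_nonneg_left (mul_nonneg hb.le (sub_nonneg.2 (sqrt_neg_leafCoord_le hx)))
  rw [← Real.sqrt_sq_eq_abs, Real.sqrt_le_sqrt_iff (sq_nonneg _)] at h
  simpa [normalFormMap, neg_le_iff_add_nonneg'] using h

theorem normalFormMap_snd_eq_zero {f b : ℝ → ℝ} {x : ℝ × ℝ} (hx : x.2 = 0)
    (hb : 0 < b (leafCoord x)) (hf : f (leafCoord x) ≤ 0) : (normalFormMap f b x).2 = 0 := by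
  have h := abs_normalFormFst (f := f) hx.ge hb
  rw [sqrt_neg_leafCoord_eq hx, sub_self, mul_zero, zero_add] at h
  rw [normalFormMap, ← sq_abs, h, Real.sq_sqrt (neg_nonneg.2 hf), add_neg_cancel]

theorem mapsTo_normalFormMap {f b : ℝ → ℝ} {I J : Set ℝ} (hb : ∀ t ∈ I, 0 < b t)
    (hf : MapsTo f I J) : MapsTo (normalFormMap f b) (leafRegion I) (leafRegion J) := fun x hx =>
  ⟨normalFormMap_snd_nonneg hx.1 (hb _ hx.2), by
    rw [leafCoord_normalFormMap]
    exact hf hx.2⟩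

theorem leftInvOn_normalFormMap {f b g c : ℝ → ℝ} {I : Set ℝ} (hb : ∀ t ∈ I, 0 < b t)
    (hf : ∀ t ∈ I, t < 0 → f t < 0) (hg : LeftInvOn g f I) (hc : ∀ t ∈ I, c (f t) * b t = 1) :
    LeftInvOn (normalFormMap g c) (normalFormMap f b) (leafRegion I) := fun x hx => by
  have hfst : normalFormFst g c (normalFormMap f b x) = x.1 := by
    have hpos := normalFormFst_pos_iff (f := f) hx.1 (hb _ hx.2) (hf _ hx.2)
    have hcb := hc _ hx.2
    rcases lt_or_ge 0 x.1 with h | h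
    · rw [normalFormFst_of_pos g c (x := normalFormMap f b x) (hpos.2 h), leafCoord_normalFormMap,
        hg hx.2]
      simp only [normalFormMap, normalFormFst_of_pos f b h]
      linear_combination (x.1 - √(-leafCoord x)) * hcb
    · rw [normalFormFst_of_nonpos g c (x := normalFormMap f b x) (not_lt.1 (mt hpos.1 h.not_gt)),
        leafCoord_normalFormMap, hg hx.2]
      simp only [normalFormMap, normalFormFst_of_nonpos f b h]
      linear_combination (x.1 + √(-leafCoord x)) * hcb
  refine Prod.ext hfst ?_
  rw [normalFormMap, hfst, leafCoord_normalFormMap, hg hx.2, leafCoord, sub_add_cancel]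

theorem boundaryShift_eq_zero {f : ℝ → ℝ} (b : ℝ → ℝ) {t : ℝ} (ht : 0 ≤ t) (hf : 0 ≤ f t) :
    boundaryShift f b t = 0 := by
  simp [boundaryShift, Real.sqrt_eq_zero_of_nonpos, ht, hf]

theorem contDiffOn_normalFormMap {f b : ℝ → ℝ} {I : Set ℝ} (hI : IsOpen I)
    (hf : ContDiffOn ℝ (⊤ : ℕ∞) f I) (hb : ContDiffOn ℝ (⊤ : ℕ∞) b I)
    (hs : ContDiffOn ℝ (⊤ : ℕ∞) (boundaryShift f b) I) (hf0 : ∀ t ∈ I, 0 ≤ t → 0 ≤ f t) :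
    ContDiffOn ℝ (⊤ : ℕ∞) (normalFormMap f b) (leafRegion I) := by
  have hm : MapsTo leafCoord (leafRegion I) I := fun x hx => hx.2
  have h1 : ContDiffOn ℝ (⊤ : ℕ∞) (normalFormFst f b) (leafRegion I) :=
    (contDiff_fst.contDiffOn.mul (hb.comp contDiff_leafCoord.contDiffOn hm)).add
      (contDiffOn_oddLift hI hs fun t ht h => boundaryShift_eq_zero b h (hf0 t ht h))
  exact h1.prodMk ((hf.comp contDiff_leafCoord.contDiffOn hm).add (h1.pow 2))

theorem exists_hasFDerivAt_normalFormMap {f b : ℝ → ℝ} {I : Set ℝ} (hI : IsOpen I)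
    (hf : DifferentiableOn ℝ f I) (hb : DifferentiableOn ℝ b I)
    (hs : DifferentiableOn ℝ (boundaryShift f b) I) (hf0 : ∀ t ∈ I, 0 ≤ t → 0 ≤ f t)
    {x : ℝ × ℝ} (hx : x ∈ leafRegion I) :
    ∃ D : ℝ × ℝ →L[ℝ] ℝ × ℝ, HasFDerivAt (normalFormMap f b) D x ∧
      D.det = deriv f (leafCoord x) * b (leafCoord x) := by
  have hnhds := hI.mem_nhds hx.2
  have h1 := ((hasFDerivAt_fst (𝕜 := ℝ) (p := x)).mul
    (hasFDerivAt_comp_leafCoord ((hb _ hx.2).differentiableAt hnhds))).add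
    (hasFDerivAt_oddLift hI hs (fun t ht h => boundaryShift_eq_zero b h (hf0 t ht h)) hx)
  have h2 := h1.prodMk ((hasFDerivAt_comp_leafCoord ((hf _ hx.2).differentiableAt hnhds)).add
    (h1.pow 2))
  refine ⟨_, h2, ?_⟩
  rw [ContinuousLinearMap.det, ← LinearMap.det_toMatrix (Module.Basis.finTwoProd ℝ),
    Matrix.det_fin_two]
  simp [LinearMap.toMatrix_apply, leafCoordDeriv]
  ring

theorem volume_image_normalFormMap {f b : ℝ → ℝ} {I : Set ℝ} (hI : IsOpen I)
    (hf : DifferentiableOn ℝ f I) (hb : DifferentiableOn ℝ b I)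
    (hs : DifferentiableOn ℝ (boundaryShift f b) I) (hf0 : ∀ t ∈ I, 0 ≤ t → 0 ≤ f t)
    (hfb : ∀ t ∈ I, deriv f t * b t = 1) (hinj : InjOn (normalFormMap f b) (leafRegion I))
    {s : Set (ℝ × ℝ)} (hsm : MeasurableSet s) (hsI : s ⊆ leafRegion I) :
    volume (normalFormMap f b '' s) = volume s := by
  choose! D hD hdet using fun x (hx : x ∈ leafRegion I) =>
    exists_hasFDerivAt_normalFormMap hI hf hb hs hf0 hx
  rw [← lintegral_abs_det_fderiv_eq_addHaar_image volume hsm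
    (fun x hx => (hD x (hsI hx)).hasFDerivWithinAt) (hinj.mono hsI)]
  rw [setLIntegral_congr_fun (g := fun _ => 1) hsm fun x hx => ?_]
  · simp
  · simp only [hdet x (hsI hx), hfb _ (hsI hx).2, abs_one, ENNReal.ofReal_one]

end NormalFormMap

section Realization

open Filter Topology

theorem boundaryShift_eq_negRpowMul {ψ : ℝ → ℝ} {t : ℝ} (hd : 0 < 1 + deriv ψ t)
    (hneg : t < 0 → t + ψ t < 0) (hpos : 0 ≤ t → 0 ≤ t + ψ t) :
    boundaryShift (fun s => s + ψ s) (fun s => (1 + deriv ψ s)⁻¹) t =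
      negRpowMul (1 / 2) (deriv ψ) t * (1 + deriv ψ t)⁻¹ -
        negRpowMul (-1 / 2) ψ t * (√(1 - negRpowMul (-1) ψ t) + 1)⁻¹ := by
  rcases lt_or_ge t 0 with ht | ht
  · have ht' : 0 < -t := neg_pos.2 ht
    have hs : 0 < √(-t) := Real.sqrt_pos.2 ht'
    have hsq : √(-t) ^ 2 = -t := Real.sq_sqrt ht'.le
    have hr : (-t) ^ (-1 / 2 : ℝ) = (√(-t))⁻¹ := by
      rw [neg_div, Real.rpow_neg ht'.le, Real.sqrt_eq_rpow]
    have hf : -(t + ψ t) = -t * (1 - (-t)⁻¹ * ψ t) := by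
      field_simp [ht.ne]
      ring
    have hw : 0 ≤ 1 - (-t)⁻¹ * ψ t :=
      (pos_of_mul_pos_right (hf ▸ neg_pos.2 (hneg ht)) ht'.le).le
    have hw2 := Real.sq_sqrt hw
    rw [negRpowMul_of_neg _ ht, negRpowMul_of_neg _ ht, negRpowMul_of_neg _ ht, hr,
      Real.rpow_neg_one, ← Real.sqrt_eq_rpow, boundaryShift, hf, Real.sqrt_mul ht'.le]
    have hw1 : 0 < √(1 - (-t)⁻¹ * ψ t) + 1 := by positivity
    rw [← hsq] at hw1 hw2 ⊢
    rw [Real.sqrt_sq hs.le] at *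
    set s := √(-t)
    set w := √(1 - (s ^ 2)⁻¹ * ψ t)
    have hψ : ψ t = s ^ 2 * (1 - w ^ 2) := by
      rw [hw2]
      field_simp
      ring
    rw [hψ]
    field_simp
    ring
  · simp [negRpowMul_of_nonneg, ht, boundaryShift_eq_zero, hpos ht]

theorem contDiffOn_boundaryShift {ψ : ℝ → ℝ} (hψ : ContDiff ℝ (⊤ : ℕ∞) ψ) (hflat : FlatAtZero ψ)
    {I : Set ℝ} (hd : ∀ t ∈ I, 0 < 1 + deriv ψ t) (hneg : ∀ t ∈ I, t < 0 → t + ψ t < 0)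
    (hpos : ∀ t ∈ I, 0 ≤ t → 0 ≤ t + ψ t) :
    ContDiffOn ℝ (⊤ : ℕ∞)
      (boundaryShift (fun s => s + ψ s) (fun s => (1 + deriv ψ s)⁻¹)) I := by
  have hψ' : ContDiff ℝ (⊤ : ℕ∞) (deriv ψ) := (contDiff_infty_iff_deriv.1 hψ).2
  have hw : ∀ t ∈ I, 1 - negRpowMul (-1) ψ t ≠ 0 := fun t ht => by
    rcases lt_or_ge t 0 with h | h
    · rw [negRpowMul_of_neg _ h, Real.rpow_neg_one]
      have h1 := hneg t ht h
      intro h2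
      field_simp [h.ne] at h2
      linarith
    · simp [negRpowMul_of_nonneg _ h]
  have hsqrt : ContDiffOn ℝ (⊤ : ℕ∞) (fun t => √(1 - negRpowMul (-1) ψ t)) I :=
    (contDiff_const.sub (contDiff_negRpowMul hψ hflat _)).contDiffOn.sqrt hw
  refine ContDiffOn.congr ?_ fun t ht =>
    boundaryShift_eq_negRpowMul (hd t ht) (hneg t ht) (hpos t ht)
  refine ((contDiff_negRpowMul hψ' hflat.deriv _).contDiffOn.mul
    ((contDiff_const.add hψ').contDiffOn.inv fun t ht => (hd t ht).ne')).sub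
    ((contDiff_negRpowMul hψ hflat _).contDiffOn.mul
      ((hsqrt.add contDiffOn_const).inv fun t _ => ?_))
  positivity

theorem exists_local_smooth_inverse {f : ℝ → ℝ} (hf : ContDiff ℝ (⊤ : ℕ∞) f) (hd : 0 < deriv f 0) :
    ∃ (I J : Set ℝ) (g : ℝ → ℝ), IsOpen I ∧ IsOpen J ∧ Convex ℝ I ∧ (0 : ℝ) ∈ I ∧ MapsTo f I J ∧
      MapsTo g J I ∧ InvOn g f I J ∧ ContDiffOn ℝ (⊤ : ℕ∞) g J ∧ ∀ t ∈ I, 0 < deriv f t := by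
  have hdiff : Differentiable ℝ f := hf.differentiable (by simp)
  have hcont : Continuous (deriv f) := hf.continuous_deriv (by simp)
  have hstrict : HasStrictDerivAt f (deriv f 0) 0 :=
    hf.contDiffAt.hasStrictDerivAt (by simp)
  let e := (hstrict.hasStrictFDerivAt_equiv hd.ne').toOpenPartialHomeomorph f
  have he0 : (0 : ℝ) ∈ e.source :=
    (hstrict.hasStrictFDerivAt_equiv hd.ne').mem_toOpenPartialHomeomorph_source
  have hnhds : e.source ∩ {t | 0 < deriv f t} ∈ 𝓝 (0 : ℝ) :=
    inter_mem (e.open_source.mem_nhds he0) ((isOpen_lt continuous_const hcont).mem_nhds hd)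
  obtain ⟨δ, hδ, hball⟩ := Metric.mem_nhds_iff.1 hnhds
  let e' := e.restrOpen (Metric.ball 0 δ) Metric.isOpen_ball
  have hI : e'.source = Metric.ball 0 δ := by
    rw [OpenPartialHomeomorph.restrOpen_source]
    exact inter_eq_right.2 fun t ht => (hball ht).1
  refine ⟨e'.source, e'.target, e'.symm, e'.open_source, e'.open_target, ?_, ?_, e'.mapsTo,
    e'.mapsTo_symm, ⟨e'.leftInvOn, e'.rightInvOn⟩, fun y hy => ?_, fun t ht => ?_⟩
  · rw [hI]
    exact convex_ball 0 δ
  · rw [hI]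
    exact Metric.mem_ball_self hδ
  · have hy' : 0 < deriv f (e'.symm y) := (hball (hI ▸ e'.mapsTo_symm hy)).2
    exact (e'.contDiffAt_symm_deriv hy'.ne' hy (hdiff _).hasDerivAt hf.contDiffAt).contDiffWithinAt
  · exact (hball (hI ▸ ht)).2

theorem leafRegion_mem_nhdsWithin {I : Set ℝ} (hI : IsOpen I) (h0 : (0 : ℝ) ∈ I) :
    leafRegion I ∈ nhdsWithin ((0 : ℝ), (0 : ℝ)) upperHalfPlane' := by
  refine inter_mem self_mem_nhdsWithin (mem_nhdsWithin_of_mem_nhds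
    ((hI.preimage (contDiff_leafCoord (n := 0)).continuous).mem_nhds ?_))
  simpa [leafCoord] using h0

end Realization

theorem boundary_hyperbolic_normal_form_realization
    (ψ : ℝ → ℝ) (hψ : ContDiff ℝ (⊤ : ℕ∞) ψ) (hflat : FlatAtZero ψ) :
    ∃ U V : Set (ℝ × ℝ),
      U ⊆ upperHalfPlane' ∧ V ⊆ upperHalfPlane' ∧
      U ∈ nhdsWithin ((0 : ℝ), (0 : ℝ)) upperHalfPlane' ∧
      V ∈ nhdsWithin ((0 : ℝ), (0 : ℝ)) upperHalfPlane' ∧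
      ∃ Φ Ψ : ℝ × ℝ → ℝ × ℝ,
        ContDiffOn ℝ (⊤ : ℕ∞) Φ U ∧ ContDiffOn ℝ (⊤ : ℕ∞) Ψ V ∧
        Set.BijOn Φ U V ∧ Set.InvOn Ψ Φ U V ∧
        Φ (0, 0) = (0, 0) ∧
        (∀ x ∈ U, x.2 = 0 → (Φ x).2 = 0) ∧
        (∀ s : Set (ℝ × ℝ), MeasurableSet s → s ⊆ U → volume (Φ '' s) = volume s) ∧
        (∀ x ∈ U, (Φ x).2 - (Φ x).1 ^ 2 = (x.2 - x.1 ^ 2) + ψ (x.2 - x.1 ^ 2)) := by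
  have hψ0 : ψ 0 = 0 := by simpa using hflat 0
  have hψ0' : deriv ψ 0 = 0 := by simpa using hflat 1
  have hψ' : ContDiff ℝ (⊤ : ℕ∞) (deriv ψ) := (contDiff_infty_iff_deriv.1 hψ).2
  set f : ℝ → ℝ := fun t => t + ψ t with hf_def
  have hf : ContDiff ℝ (⊤ : ℕ∞) f := contDiff_id.add hψ
  have hf0 : f 0 = 0 := by simp [f, hψ0]
  have hdf : ∀ t, deriv f t = 1 + deriv ψ t := fun t =>
    ((hasDerivAt_id t).add ((hψ.differentiable (by simp)) t).hasDerivAt).deriv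
  obtain ⟨I, J, g, hI, hJ, hconv, h0I, hfIJ, hgJI, hinv, hg, hpos⟩ :=
    exists_local_smooth_inverse hf (by simp [hdf, hψ0'])
  have hmono : StrictMonoOn f I := strictMonoOn_of_deriv_pos hconv hf.continuous.continuousOn
    fun t ht => hpos t (interior_subset ht)
  have hfneg : ∀ t ∈ I, t < 0 → f t < 0 := fun t ht h => hf0 ▸ hmono ht h0I h
  have hfnonneg : ∀ t ∈ I, 0 ≤ t → 0 ≤ f t := fun t ht h => hf0 ▸ hmono.monotoneOn h0I ht h
  have hgneg : ∀ t ∈ J, t < 0 → g t < 0 := fun t ht h => by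
    by_contra! hc
    have := hfnonneg _ (hgJI ht) hc
    rw [hinv.2 ht] at this
    exact this.not_gt h
  have hgnonneg : ∀ t ∈ J, 0 ≤ t → 0 ≤ g t := fun t ht h => by
    by_contra! hc
    have := hfneg _ (hgJI ht) hc
    rw [hinv.2 ht] at this
    exact this.not_ge h
  set b : ℝ → ℝ := fun t => (1 + deriv ψ t)⁻¹ with hb_def
  set c : ℝ → ℝ := fun t => 1 + deriv ψ (g t) with hc_def
  have hd : ∀ t ∈ I, 0 < 1 + deriv ψ t := fun t ht => hdf t ▸ hpos t ht
  have hbpos : ∀ t ∈ I, 0 < b t := fun t ht => inv_pos.2 (hd t ht)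
  have hcpos : ∀ t ∈ J, 0 < c t := fun t ht => hd _ (hgJI ht)
  have hcb : ∀ t ∈ I, c (f t) * b t = 1 := fun t ht => by
    simp only [hc_def, hb_def, hinv.1 ht]
    exact mul_inv_cancel₀ (hd t ht).ne'
  have hbc : ∀ t ∈ J, b (g t) * c t = 1 := fun t ht => inv_mul_cancel₀ (hcpos t ht).ne'
  have hb : ContDiffOn ℝ (⊤ : ℕ∞) b I :=
    (contDiff_const.add hψ').contDiffOn.inv fun t ht => (hd t ht).ne'
  have hc : ContDiffOn ℝ (⊤ : ℕ∞) c J := contDiffOn_const.add (hψ'.comp_contDiffOn hg)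
  have hshift : ContDiffOn ℝ (⊤ : ℕ∞) (boundaryShift f b) I :=
    contDiffOn_boundaryShift hψ hflat hd hfneg hfnonneg
  have hshift' : ContDiffOn ℝ (⊤ : ℕ∞) (boundaryShift g c) J := by
    refine (hc.mul (hshift.comp hg hgJI)).neg.congr fun t ht => ?_
    simp only [boundaryShift, Function.comp_apply, hinv.2 ht]
    linear_combination -√(-g t) * hbc t ht
  have hmaps := mapsTo_normalFormMap hbpos hfIJ
  have hmaps' := mapsTo_normalFormMap hcpos hgJI
  have hinvOn : InvOn (normalFormMap g c) (normalFormMap f b) (leafRegion I) (leafRegion J) :=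
    ⟨leftInvOn_normalFormMap hbpos hfneg hinv.1 hcb,
      leftInvOn_normalFormMap hcpos hgneg hinv.2 hbc⟩
  refine ⟨leafRegion I, leafRegion J, fun x hx => hx.1, fun x hx => hx.1,
    leafRegion_mem_nhdsWithin hI h0I, leafRegion_mem_nhdsWithin hJ (hf0 ▸ hfIJ h0I),
    normalFormMap f b, normalFormMap g c,
    contDiffOn_normalFormMap hI hf.contDiffOn hb hshift hfnonneg,
    contDiffOn_normalFormMap hJ hg hc hshift' hgnonneg,
    hinvOn.bijOn hmaps hmaps', hinvOn, ?_, fun x hx h => ?_, fun s hs hsI => ?_, fun x _ => ?_⟩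
  · simp [normalFormMap, normalFormFst, oddLift, boundaryShift, leafCoord, hf0]
  · refine normalFormMap_snd_eq_zero h (hbpos _ hx.2) ?_
    have hle : leafCoord x ≤ 0 := by simp [leafCoord, h, sq_nonneg]
    exact hf0 ▸ hmono.monotoneOn hx.2 h0I hle
  · exact volume_image_normalFormMap hI (hf.differentiable (by simp)).differentiableOn
      (hb.differentiableOn (by simp)) (hshift.differentiableOn (by simp)) hfnonneg
      (fun t ht => by rw [hdf]; exact mul_inv_cancel₀ (hd t ht).ne') hinvOn.1.injOn hs hsI
  · exact leafCoord_normalFormMap f b x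
end
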